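/- arXiv:1212.5431 — 2 statements merged into one kernel-verified Lean document; each statement's English description precedes it below -/
import Mathlib

section
/- Let {B_x}_{x∈H} be a countable family of closed balls in ℝ^d, B_x centered at x with radius r(x), such that the doubled balls 2B_x are pairwise disjoint. For each x ∈ H let Π_x be an n-plane through x and P_x = Π_x ∩ B_x, and set σ = Σ_{x∈H} H^n⌊P_x. For z ∈ ∪_x B_x let B(z) denote the ball B_x containing z, and define the local operator R^{loc}_{σ,ε} f(z) = R̃_{σ,ε}(f·χ_{B(z)})(z). Then there is a constant c depending only on d and n (independent of ε and of the family) such that ‖R^{loc}_{σ,ε} f‖_{L²(σ)} ≤ c ‖f‖_{L²(σ)} for all f ∈ L²(σ) and all ε > 0. -/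
open MeasureTheory Metric Set Filter
open scoped ENNReal NNReal Topology

noncomputable section

abbrev Euc (d : ℕ) := EuclideanSpace ℝ (Fin d)

/-- The `ε`-truncated `n`-dimensional Riesz transform of `f μ`. -/
def truncRiesz (n : ℕ) {d : ℕ} (μ : Measure (Euc d)) (ε : ℝ) (f : Euc d → ℝ)
    (x : Euc d) : Euc d :=
  ∫ y in {y : Euc d | ε < ‖x - y‖}, (‖x - y‖ ^ (n + 1))⁻¹ • f y • (x - y) ∂μ

/-- The `ε`-regularized `n`-dimensional Riesz transform of `f μ`, with kernel
`K_ε(x) = x / max(|x|, ε)^(n+1)`. -/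
def regRiesz (n : ℕ) {d : ℕ} (μ : Measure (Euc d)) (ε : ℝ) (f : Euc d → ℝ)
    (x : Euc d) : Euc d :=
  ∫ y, ((max ‖x - y‖ ε) ^ (n + 1))⁻¹ • f y • (x - y) ∂μ

/-- `R_μ` is bounded in `L²(μ)`: the truncated operators are bounded uniformly in `ε > 0`. -/
def RieszBounded (n : ℕ) {d : ℕ} (μ : Measure (Euc d)) : Prop :=
  ∃ C : ℝ, 0 < C ∧ ∀ ε : ℝ, 0 < ε → ∀ f : Euc d → ℝ, Measurable f →
    ∫⁻ x, (‖truncRiesz n μ ε f x‖₊ : ℝ≥0∞) ^ 2 ∂μ ≤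
      ENNReal.ofReal C * ∫⁻ x, (‖f x‖₊ : ℝ≥0∞) ^ 2 ∂μ

/-- The regularized operators `R̃_{μ,ε}` are bounded in `L²(μ)` uniformly in `ε > 0`. -/
def RegRieszBounded (n : ℕ) {d : ℕ} (μ : Measure (Euc d)) : Prop :=
  ∃ C : ℝ, 0 < C ∧ ∀ ε : ℝ, 0 < ε → ∀ f : Euc d → ℝ, Measurable f →
    ∫⁻ x, (‖regRiesz n μ ε f x‖₊ : ℝ≥0∞) ^ 2 ∂μ ≤
      ENNReal.ofReal C * ∫⁻ x, (‖f x‖₊ : ℝ≥0∞) ^ 2 ∂μ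

/-- `μ` has growth of degree `n` with constant `c`. -/
def GrowthDeg (n : ℕ) {d : ℕ} (μ : Measure (Euc d)) (c : ℝ) : Prop :=
  ∀ (x : Euc d) (r : ℝ), 0 < r → μ (closedBall x r) ≤ ENNReal.ofReal (c * r ^ n)

/-- A set is `n`-rectifiable: up to an `H^n`-null set it is contained in a countable union of
Lipschitz images of `ℝ^n`. -/
def IsRectifiable (n : ℕ) {d : ℕ} (E : Set (Euc d)) : Prop :=
  ∃ (f : ℕ → EuclideanSpace ℝ (Fin n) → Euc d) (K : ℕ → ℝ≥0),
    (∀ i, LipschitzWith (K i) (f i)) ∧ μH[(n : ℝ)] (E \ ⋃ i, Set.range (f i)) = 0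

/-- Every `n`-rectifiable subset has `H^n` measure zero. -/
def PurelyUnrectifiable (n : ℕ) {d : ℕ} (E : Set (Euc d)) : Prop :=
  ∀ F, F ⊆ E → IsRectifiable n F → μH[(n : ℝ)] F = 0

/-- The support of a measure. -/
def measureSupport {d : ℕ} (μ : Measure (Euc d)) : Set (Euc d) :=
  {x | ∀ r : ℝ, 0 < r → 0 < μ (ball x r)}

/-- The lower `n`-dimensional density `θⁿ_*(x, μ)`. -/
def lowerDensity (n : ℕ) {d : ℕ} (μ : Measure (Euc d)) (x : Euc d) : ℝ≥0∞ :=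
  Filter.liminf (fun r : ℝ => μ (closedBall x r) / ENNReal.ofReal (r ^ n)) (𝓝[>] (0 : ℝ))

/-- `μ` is Ahlfors–David regular of dimension `n`. -/
def ADRegular (n : ℕ) {d : ℕ} (μ : Measure (Euc d)) : Prop :=
  ∃ c : ℝ, 1 ≤ c ∧ ∀ x ∈ measureSupport μ, ∀ r : ℝ, 0 < r →
    ENNReal.ofReal r ≤ EMetric.diam (measureSupport μ) →
    ENNReal.ofReal (c⁻¹ * r ^ n) ≤ μ (closedBall x r) ∧
      μ (closedBall x r) ≤ ENNReal.ofReal (c * r ^ n)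

/-- An `n`-dimensional affine plane in `ℝ^d`. -/
def IsAffineNPlane (n : ℕ) {d : ℕ} (W : Set (Euc d)) : Prop :=
  ∃ (a : Euc d) (V : Submodule ℝ (Euc d)), Module.finrank ℝ V = n ∧
    W = (fun v => a + v) '' (V : Set (Euc d))

/-- The centered Hardy–Littlewood maximal operator with respect to `μ`. -/
def maximalOp {d : ℕ} (μ : Measure (Euc d)) (f : Euc d → ℝ) (x : Euc d) : ℝ≥0∞ :=
  ⨆ (r : ℝ) (_ : 0 < r),
    (μ (closedBall x r))⁻¹ * ∫⁻ y in closedBall x r, (‖f y‖₊ : ℝ≥0∞) ∂μ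

/-- Harmonicity on a set, expressed through continuity together with the mean value property
over closed balls. -/
def MeanValueHarmonicOn {d : ℕ} (f : Euc d → ℝ) (U : Set (Euc d)) : Prop :=
  ContinuousOn f U ∧ ∀ x ∈ U, ∀ r : ℝ, 0 < r → closedBall x r ⊆ U →
    f x = ⨍ y in closedBall x r, f y ∂volume

/-- `E` is removable for Lipschitz harmonic functions. -/
def RemovableForLipschitzHarmonic {d : ℕ} (E : Set (Euc d)) : Prop :=
  ∀ Ω : Set (Euc d), IsOpen Ω → ∀ f : Euc d → ℝ,
    (∃ K : ℝ≥0, LipschitzOnWith K f Ω) →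
    MeanValueHarmonicOn f (Ω \ E) → MeanValueHarmonicOn f Ω

/-- The distance between two sets. -/
def ballsDist {d : ℕ} (A B : Set (Euc d)) : ℝ :=
  sInf (Set.image2 dist A B)

end

section AlmostOrthogonality

variable {H : Type*} [NormedAddCommGroup H] [InnerProductSpace ℝ H]

/-- The powers of a sum of almost orthogonal operators are sums of words with summable norms. -/
lemma exists_word_expansion {N : ℕ} (T : Fin N → H →L[ℝ] H) (c : Fin N → Fin N → ℝ) (B M : ℝ)
    (hc0 : ∀ i j, 0 ≤ c i j) (hc : ∀ i j, ‖T i * T j‖ ≤ c i j ^ 2) (hM : ∀ i, ‖T i‖ ≤ M)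
    (hB0 : 0 ≤ B) (hB : ∀ i, ∑ j, c i j ≤ B) (m : ℕ) (i : Fin N) :
    ∃ (ι : Type) (_ : Fintype ι) (Y : ι → H →L[ℝ] H), ∑ w, Y w = (∑ j, T j) ^ m ∧
      ∑ w, √(‖T i * Y w‖ * ‖Y w‖) ≤ √M * B ^ m := by
  induction m generalizing i with
  | zero =>
    refine ⟨Unit, inferInstance, fun _ => 1, by simp, ?_⟩
    simp only [Finset.univ_unique, Finset.sum_const, Finset.card_singleton, one_smul, mul_one,
      pow_zero]
    apply Real.sqrt_le_sqrt
    calc ‖T i‖ * ‖(1 : H →L[ℝ] H)‖ ≤ ‖T i‖ * 1 := by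
          gcongr
          exact ContinuousLinearMap.norm_id_le
      _ ≤ M := by simpa using hM i
  | succ m ih =>
    choose ι hι Y hY hYs using ih
    refine ⟨Σ j, ι j, inferInstance, fun p => T p.1 * Y p.1 p.2, ?_, ?_⟩
    · rw [Fintype.sum_sigma, pow_succ', Finset.sum_mul]
      refine Finset.sum_congr rfl fun j _ => ?_
      rw [← hY j, Finset.mul_sum]
    · rw [Fintype.sum_sigma]
      calc ∑ j, ∑ w, √(‖T i * (T j * Y j w)‖ * ‖T j * Y j w‖)
          ≤ ∑ j, ∑ w, c i j * √(‖T j * Y j w‖ * ‖Y j w‖) := by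
            refine Finset.sum_le_sum fun j _ => Finset.sum_le_sum fun w _ => ?_
            apply Real.sqrt_le_iff.2
            refine ⟨mul_nonneg (hc0 _ _) (Real.sqrt_nonneg _), ?_⟩
            rw [mul_pow, Real.sq_sqrt (by positivity), ← mul_assoc]
            calc ‖T i * T j * Y j w‖ * ‖T j * Y j w‖
                ≤ (‖T i * T j‖ * ‖Y j w‖) * ‖T j * Y j w‖ := by
                  gcongr
                  exact norm_mul_le _ _
              _ ≤ (c i j ^ 2 * ‖Y j w‖) * ‖T j * Y j w‖ := by
                  gcongr
                  exact hc i j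
              _ = _ := by ring
        _ ≤ ∑ j, c i j * (√M * B ^ m) := by
            refine Finset.sum_le_sum fun j _ => ?_
            rw [← Finset.mul_sum]
            exact mul_le_mul_of_nonneg_left (hYs j) (hc0 _ _)
        _ ≤ B * (√M * B ^ m) := by
            rw [← Finset.sum_mul]
            exact mul_le_mul_of_nonneg_right (hB i) (by positivity)
        _ = _ := by ring

/-- **Cotlar–Stein lemma** for skew-adjoint operators. -/
lemma norm_sum_le_of_almost_orthogonal [CompleteSpace H] {N : ℕ}
    (T : Fin N → H →L[ℝ] H) (c : Fin N → Fin N → ℝ)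
    (B : ℝ) (hT : ∀ i, star (T i) = -T i) (hc0 : ∀ i j, 0 ≤ c i j)
    (hc : ∀ i j, ‖T i * T j‖ ≤ c i j ^ 2) (hB0 : 0 < B) (hB : ∀ i, ∑ j, c i j ≤ B) :
    ‖∑ j, T j‖ ≤ B := by
  set S := ∑ j, T j with hS
  have hSs : star S = -S := by
    rw [hS, star_sum, ← Finset.sum_neg_distrib]
    exact Finset.sum_congr rfl fun i _ => hT i
  obtain ⟨M, hM0, hM⟩ : ∃ M : ℝ, 0 ≤ M ∧ ∀ i, ‖T i‖ ≤ M :=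
    ⟨∑ i, ‖T i‖, by positivity,
      fun i => Finset.single_le_sum (fun j _ => norm_nonneg (T j)) (Finset.mem_univ i)⟩
  have hpow : ∀ m, ‖S ^ (m + 1)‖ ≤ N * M * B ^ m := by
    intro m
    have key : ∀ i, ‖T i * S ^ m‖ ≤ M * B ^ m := by
      intro i
      obtain ⟨ι, _, Y, hY, hYs⟩ := exists_word_expansion T c B M hc0 hc hM hB0.le hB m i
      rw [← hY, Finset.mul_sum]
      calc ‖∑ w, T i * Y w‖ ≤ ∑ w, ‖T i * Y w‖ := norm_sum_le _ _
        _ ≤ ∑ w, √M * √(‖T i * Y w‖ * ‖Y w‖) := by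
            refine Finset.sum_le_sum fun w _ => ?_
            rw [← Real.sqrt_mul hM0]
            apply Real.le_sqrt_of_sq_le
            have : ‖T i * Y w‖ ≤ M * ‖Y w‖ :=
              (norm_mul_le _ _).trans (by gcongr; exact hM i)
            nlinarith [norm_nonneg (T i * Y w)]
        _ ≤ √M * (√M * B ^ m) := by
            rw [← Finset.mul_sum]
            gcongr
        _ = M * B ^ m := by rw [← mul_assoc, Real.mul_self_sqrt hM0]
    rw [pow_succ', hS, Finset.sum_mul]
    refine (norm_sum_le _ _).trans ((Finset.sum_le_sum fun i _ => key i).trans ?_)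
    simp [mul_assoc]
  have hpow2 : ∀ k : ℕ, ‖S‖ ^ (2 * 2 ^ k) = ‖S ^ (2 * 2 ^ k)‖ := by
    intro k
    have h2 : IsSelfAdjoint (S ^ 2) := by rw [IsSelfAdjoint, star_pow, hSs, neg_sq]
    rw [pow_mul S, IsSelfAdjoint.norm_pow_two_pow h2, pow_mul]
    congr 1
    have := CStarRing.norm_star_mul_self (x := S)
    rw [hSs, neg_mul, norm_neg] at this
    rw [sq, sq, this]
  by_contra! hlt
  have h1 : 1 < ‖S‖ / B := (one_lt_div hB0).2 hlt
  obtain ⟨k, hk⟩ := ((tendsto_pow_atTop_atTop_of_one_lt h1).eventually_gt_atTop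
    (N * M / B)).exists_forall_of_atTop
  have hkk : k ≤ 2 * 2 ^ k := by
    have := Nat.lt_two_pow_self (n := k)
    omega
  have h3 := hk _ hkk
  rw [div_pow, hpow2 k] at h3
  obtain ⟨q, hq⟩ : ∃ q, 2 * 2 ^ k = q + 1 :=
    ⟨2 * 2 ^ k - 1, by have := Nat.two_pow_pos k; omega⟩
  rw [hq] at h3
  have h4 := hpow q
  rw [div_lt_div_iff₀ hB0 (by positivity), pow_succ] at h3
  nlinarith

end AlmostOrthogonality

lemma norm_integral_smul_isometry_le {E : Type*} [MeasurableSpace E] {μ : Measure E}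
    {H : Type*} [NormedAddCommGroup H] [InnerProductSpace ℝ H] {k : E → ℝ}
    (U : E → H →ₗᵢ[ℝ] H) (v : H) :
    ‖∫ x, k x • U x v ∂μ‖ ≤ (∫ x, |k x| ∂μ) * ‖v‖ := by
  refine (norm_integral_le_integral_norm _).trans_eq ?_
  simp [norm_smul, integral_mul_const]

section TranslationOperators

variable {E : Type*} [NormedAddCommGroup E] [MeasurableSpace E] [BorelSpace E]
  [SecondCountableTopology E] {μ : Measure E}
  {H : Type*} [NormedAddCommGroup H] [InnerProductSpace ℝ H]

lemma integrable_smul_isometry {k : E → ℝ} (hk : Integrable k μ) (U : E → H →ₗᵢ[ℝ] H)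
    (hU : ∀ v, Continuous fun x => U x v) (v : H) : Integrable (fun x => k x • U x v) μ := by
  refine (hk.norm.mul_const ‖v‖).mono' (hk.aestronglyMeasurable.smul
    (hU v).aestronglyMeasurable) (ae_of_all _ fun x => ?_)
  simp [norm_smul]

/-- The operator `∫ k(x) U_x dμ(x)` obtained by integrating a strongly continuous family of
isometries against an integrable kernel. -/
noncomputable def integralOp (μ : Measure E) (U : E → H →ₗᵢ[ℝ] H)
    (hU : ∀ v, Continuous fun x => U x v) {k : E → ℝ} (hk : Integrable k μ) : H →L[ℝ] H :=
  LinearMap.mkContinuous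
    { toFun := fun v => ∫ x, k x • U x v ∂μ
      map_add' := fun v w => by
        simp only [map_add, smul_add]
        exact integral_add (integrable_smul_isometry hk U hU v) (integrable_smul_isometry hk U hU w)
      map_smul' := fun a v => by
        simp only [map_smul, RingHom.id_apply, smul_comm _ a, integral_smul] }
    (∫ x, |k x| ∂μ) (fun v => norm_integral_smul_isometry_le U v)

lemma integralOp_apply (U : E → H →ₗᵢ[ℝ] H) (hU : ∀ v, Continuous fun x => U x v) {k : E → ℝ}
    (hk : Integrable k μ) (v : H) : integralOp μ U hU hk v = ∫ x, k x • U x v ∂μ := rfl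

lemma star_integralOp [CompleteSpace H] [μ.IsNegInvariant] (U : E → H →ₗᵢ[ℝ] H)
    (hU : ∀ v, Continuous fun x => U x v)
    (hadd : ∀ x y v, U (x + y) v = U x (U y v)) (hzero : ∀ v, U 0 v = v) {k : E → ℝ}
    (hk : Integrable k μ) (hodd : ∀ x, k (-x) = -k x) :
    star (integralOp μ U hU hk) = -integralOp μ U hU hk := by
  rw [ContinuousLinearMap.star_eq_adjoint]
  symm
  rw [ContinuousLinearMap.eq_adjoint_iff]
  intro v w
  simp only [neg_apply, inner_neg_left, integralOp_apply]
  rw [← integral_inner (integrable_smul_isometry hk U hU w), real_inner_comm,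
    ← integral_inner (integrable_smul_isometry hk U hU v), ← integral_neg,
    ← integral_neg_eq_self]
  refine integral_congr_ae (ae_of_all _ fun x => ?_)
  have h : v = U x (U (-x) v) := by rw [← hadd]; simp [hzero]
  simp only [hodd, inner_smul_right, neg_mul, neg_neg]
  conv_rhs => rw [h, LinearIsometry.inner_map_map, real_inner_comm]

lemma norm_integralOp_mul_le [CompleteSpace H] [μ.IsAddLeftInvariant] (U : E → H →ₗᵢ[ℝ] H)
    (hU : ∀ v, Continuous fun x => U x v)
    (hadd : ∀ x y v, U (x + y) v = U x (U y v)) {k l : E → ℝ}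
    (hk : Integrable k μ) (hl : Integrable l μ) (hk0 : ∫ x, k x ∂μ = 0) {A η : ℝ} (hη : 0 ≤ η)
    (hA : ∫ x, |k x| ∂μ ≤ A)
    (hlη : ∀ x, k x ≠ 0 → ∫ y, |l (-x + y) - l y| ∂μ ≤ η) :
    ‖integralOp μ U hU hk * integralOp μ U hU hl‖ ≤ A * η := by
  have hA0 : 0 ≤ A := (integral_nonneg fun x => abs_nonneg _).trans hA
  refine ContinuousLinearMap.opNorm_le_bound _ (by positivity) fun v => ?_
  set L := integralOp μ U hU hl v with hL
  have h1 : (integralOp μ U hU hk * integralOp μ U hU hl) v = ∫ x, k x • (U x L - L) ∂μ := by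
    rw [mul_apply_eq_comp, integralOp_apply]
    simp only [smul_sub]
    rw [integral_sub (integrable_smul_isometry hk U hU _) (hk.smul_const _), integral_smul_const,
      hk0, zero_smul, sub_zero]
  have h2 : ∀ x, U x L - L = ∫ y, (l (-x + y) - l y) • U y v ∂μ := by
    intro x
    have e1 : U x L = ∫ y, l (-x + y) • U y v ∂μ := by
      rw [hL, integralOp_apply, ← integral_add_left_eq_self _ (-x)]
      rw [← LinearIsometry.coe_toContinuousLinearMap, ← ContinuousLinearMap.integral_comp_comm]
      · refine integral_congr_ae (ae_of_all _ fun y => ?_)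
        simp [← hadd]
      · exact (integrable_smul_isometry hl U hU v).comp_add_left (-x)
    simp only [sub_smul]
    rw [integral_sub (integrable_smul_isometry (hl.comp_add_left (-x)) U hU v)
      (integrable_smul_isometry hl U hU v), ← e1, hL, integralOp_apply]
  rw [h1]
  calc ‖∫ x, k x • (U x L - L) ∂μ‖ ≤ ∫ x, |k x| * (η * ‖v‖) ∂μ := by
        refine norm_integral_le_of_norm_le (hk.abs.mul_const _) (ae_of_all _ fun x => ?_)
        rw [norm_smul, Real.norm_eq_abs]
        by_cases hx : k x = 0
        · simp [hx]
        · gcongr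
          rw [h2]
          exact (norm_integral_smul_isometry_le U v).trans (by gcongr; exact hlη x hx)
    _ = (∫ x, |k x| ∂μ) * (η * ‖v‖) := integral_mul_const _ _
    _ ≤ A * (η * ‖v‖) := by gcongr
    _ = _ := by ring

end TranslationOperators

section Kernel

variable {E : Type*} [NormedAddCommGroup E] [InnerProductSpace ℝ E]

/-- The component in direction `e` of the regularized `n`-dimensional Riesz kernel. -/
noncomputable def rieszKernel (n : ℕ) (e : E) (δ : ℝ) (x : E) : ℝ :=
  (max ‖x‖ δ ^ (n + 1))⁻¹ * inner ℝ e x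

lemma rieszKernel_neg (n : ℕ) (e : E) (δ : ℝ) (x : E) :
    rieszKernel n e δ (-x) = -rieszKernel n e δ x := by
  simp [rieszKernel]

lemma abs_rieszKernel_le (n : ℕ) {e : E} (he : ‖e‖ ≤ 1) {δ : ℝ} (hδ : 0 < δ) (x : E) :
    |rieszKernel n e δ x| ≤ (δ ^ n)⁻¹ := by
  have hm : δ ≤ max ‖x‖ δ := le_max_right _ _
  have hm0 : 0 < max ‖x‖ δ := hδ.trans_le hm
  have h1 : |inner ℝ e x| ≤ max ‖x‖ δ :=
    (abs_real_inner_le_norm e x).trans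
      ((mul_le_of_le_one_left (norm_nonneg _) he).trans (le_max_left _ _))
  rw [rieszKernel, abs_mul, abs_of_pos (by positivity)]
  calc (max ‖x‖ δ ^ (n + 1))⁻¹ * |inner ℝ e x|
      ≤ (max ‖x‖ δ ^ (n + 1))⁻¹ * max ‖x‖ δ := by gcongr
    _ = (max ‖x‖ δ ^ n)⁻¹ := by field_simp; ring
    _ ≤ (δ ^ n)⁻¹ := by gcongr

lemma continuous_rieszKernel (n : ℕ) (e : E) {δ : ℝ} (hδ : 0 < δ) :
    Continuous (rieszKernel n e δ) := by
  unfold rieszKernel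
  refine Continuous.mul (Continuous.inv₀ (by fun_prop) fun x => ?_) (by fun_prop)
  have : 0 < max ‖x‖ δ := hδ.trans_le (le_max_right _ _)
  positivity

lemma abs_rieszKernel_sub_le (n : ℕ) {e : E} (he : ‖e‖ ≤ 1) {δ : ℝ} (hδ : 0 < δ) (x y : E) :
    |rieszKernel n e δ x - rieszKernel n e δ y| ≤ (n + 2) * ‖x - y‖ * (δ ^ (n + 1))⁻¹ := by
  wlog hxy : max ‖y‖ δ ≤ max ‖x‖ δ generalizing x y
  · rw [abs_sub_comm, norm_sub_rev]
    exact this y x (le_of_not_ge hxy)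
  have hmx : 0 < max ‖x‖ δ := hδ.trans_le (le_max_right _ _)
  have hmy : 0 < max ‖y‖ δ := hδ.trans_le (le_max_right _ _)
  set a := (max ‖x‖ δ)⁻¹ with ha
  set b := (max ‖y‖ δ)⁻¹ with hb
  have ha0 : 0 < a := by positivity
  have hb0 : 0 < b := by positivity
  have hab : a ≤ b := by rw [ha, hb]; gcongr
  have hbδ : b ≤ δ⁻¹ := by rw [hb]; gcongr; exact le_max_right _ _
  have hxa : |inner ℝ e x| * a ≤ 1 := by
    rw [ha, ← div_eq_mul_inv, div_le_one hmx]
    exact (abs_real_inner_le_norm e x).trans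
      ((mul_le_of_le_one_left (norm_nonneg _) he).trans (le_max_left _ _))
  have hdiff : |a - b| ≤ ‖x - y‖ * (a * b) := by
    have h1 : a - b = (max ‖y‖ δ - max ‖x‖ δ) * (a * b) := by
      rw [ha, hb]; field_simp
    rw [h1, abs_mul, abs_of_pos (mul_pos ha0 hb0)]
    gcongr
    refine (abs_max_sub_max_le_abs _ _ _).trans ?_
    rw [norm_sub_rev]
    exact abs_norm_sub_norm_le _ _
  have hpow : |a ^ (n + 1) - b ^ (n + 1)| ≤ ‖x - y‖ * (a * b) * (n + 1) * b ^ n := by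
    refine (abs_pow_sub_pow_le a b (n + 1)).trans ?_
    rw [abs_of_pos ha0, abs_of_pos hb0, max_eq_right hab]
    rw [Nat.add_sub_cancel, Nat.cast_add_one]
    gcongr
  have hxe : |inner ℝ e (x - y)| ≤ ‖x - y‖ :=
    (abs_real_inner_le_norm e _).trans (mul_le_of_le_one_left (norm_nonneg _) he)
  have heq : rieszKernel n e δ x - rieszKernel n e δ y
      = inner ℝ e (x - y) * b ^ (n + 1) + inner ℝ e x * (a ^ (n + 1) - b ^ (n + 1)) := by
    simp only [rieszKernel, ← inv_pow, inner_sub_right, ← ha, ← hb]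
    ring
  rw [heq]
  calc _ ≤ |inner ℝ e (x - y)| * b ^ (n + 1)
        + |inner ℝ e x| * |a ^ (n + 1) - b ^ (n + 1)| := by
        refine (abs_add_le _ _).trans_eq ?_
        rw [abs_mul, abs_mul, abs_of_pos (pow_pos hb0 (n + 1))]
    _ ≤ ‖x - y‖ * b ^ (n + 1) + |inner ℝ e x| * (‖x - y‖ * (a * b) * (n + 1) * b ^ n) := by
        gcongr
    _ = ‖x - y‖ * b ^ (n + 1) + (|inner ℝ e x| * a) * (‖x - y‖ * (n + 1) * b ^ (n + 1)) := by
        ring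
    _ ≤ ‖x - y‖ * b ^ (n + 1) + 1 * (‖x - y‖ * (n + 1) * b ^ (n + 1)) := by
        gcongr
    _ = (n + 2) * ‖x - y‖ * b ^ (n + 1) := by ring
    _ ≤ (n + 2) * ‖x - y‖ * (δ⁻¹) ^ (n + 1) := by gcongr
    _ = _ := by rw [inv_pow]

/-- The part of the Riesz kernel living at scale `δ`. -/
noncomputable def rieszPiece (n : ℕ) (e : E) (δ : ℝ) (x : E) : ℝ :=
  rieszKernel n e δ x - rieszKernel n e (2 * δ) x

lemma rieszPiece_neg (n : ℕ) (e : E) (δ : ℝ) (x : E) :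
    rieszPiece n e δ (-x) = -rieszPiece n e δ x := by
  simp only [rieszPiece, rieszKernel_neg]; ring

lemma continuous_rieszPiece (n : ℕ) (e : E) {δ : ℝ} (hδ : 0 < δ) :
    Continuous (rieszPiece n e δ) :=
  (continuous_rieszKernel n e hδ).sub (continuous_rieszKernel n e (by positivity))

lemma rieszPiece_eq_zero (n : ℕ) (e : E) {δ : ℝ} (hδ : 0 < δ) {x : E} (hx : 2 * δ < ‖x‖) :
    rieszPiece n e δ x = 0 := by
  rw [rieszPiece, rieszKernel, rieszKernel, max_eq_left hx.le, max_eq_left (by linarith), sub_self]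

lemma abs_rieszPiece_le (n : ℕ) {e : E} (he : ‖e‖ ≤ 1) {δ : ℝ} (hδ : 0 < δ) (x : E) :
    |rieszPiece n e δ x| ≤ 2 * (δ ^ n)⁻¹ := by
  have h1 := abs_rieszKernel_le n he hδ x
  have h2 := abs_rieszKernel_le n he (show 0 < 2 * δ by positivity) x
  have h3 : ((2 * δ) ^ n)⁻¹ ≤ (δ ^ n)⁻¹ := by gcongr; linarith
  refine (abs_sub _ _).trans ?_
  linarith

lemma abs_rieszPiece_sub_le (n : ℕ) {e : E} (he : ‖e‖ ≤ 1) {δ : ℝ} (hδ : 0 < δ) (x y : E) :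
    |rieszPiece n e δ x - rieszPiece n e δ y| ≤ 2 * (n + 2) * ‖x - y‖ * (δ ^ (n + 1))⁻¹ := by
  have h1 := abs_rieszKernel_sub_le n he hδ x y
  have h2 := abs_rieszKernel_sub_le n he (show 0 < 2 * δ by positivity) x y
  have h3 : (n + 2) * ‖x - y‖ * ((2 * δ) ^ (n + 1))⁻¹ ≤ (n + 2) * ‖x - y‖ * (δ ^ (n + 1))⁻¹ := by
    gcongr; linarith
  have h4 : rieszPiece n e δ x - rieszPiece n e δ y
    = (rieszKernel n e δ x - rieszKernel n e δ y)
      - (rieszKernel n e (2 * δ) x - rieszKernel n e (2 * δ) y) := by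
    simp only [rieszPiece]; ring
  rw [h4]
  refine (abs_sub _ _).trans ?_
  linarith

variable [FiniteDimensional ℝ E] [MeasurableSpace E] [BorelSpace E] {μ : Measure E}
  [μ.IsAddHaarMeasure]

lemma integral_abs_le_of_support_subset_closedBall {g : E → ℝ} {R C : ℝ} (hR : 0 ≤ R)
    (hC : ∀ x, |g x| ≤ C) (hg : ∀ x, R < ‖x‖ → g x = 0) :
    ∫ x, |g x| ∂μ ≤ C * (R ^ Module.finrank ℝ E * μ.real (closedBall 0 1)) := by
  have h1 : ∫ x, |g x| ∂μ = ∫ x in closedBall 0 R, |g x| ∂μ := by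
    refine (setIntegral_eq_integral_of_forall_compl_eq_zero fun x hx => ?_).symm
    rw [hg x (by simpa using hx), abs_zero]
  have h2 : μ.real (closedBall 0 R) = R ^ Module.finrank ℝ E * μ.real (closedBall 0 1) := by
    rw [measureReal_def, Measure.addHaar_closedBall' μ 0 hR, ENNReal.toReal_mul,
      ENNReal.toReal_ofReal (by positivity), measureReal_def]
  rw [h1, ← h2]
  refine (le_abs_self _).trans ?_
  refine norm_setIntegral_le_of_norm_le_const (f := fun x => |g x|)
    (measure_closedBall_lt_top (μ := μ)) fun x _ => ?_
  simpa using hC x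

lemma integrable_rieszPiece (n : ℕ) (e : E) {δ : ℝ} (hδ : 0 < δ) :
    Integrable (rieszPiece n e δ) μ := by
  refine (continuous_rieszPiece n e hδ).integrable_of_hasCompactSupport ?_
  refine HasCompactSupport.intro (isCompact_closedBall (0 : E) (2 * δ)) fun x hx => ?_
  exact rieszPiece_eq_zero n e hδ (by simpa using hx)

lemma integral_abs_rieszPiece_le {e : E} (he : ‖e‖ ≤ 1) {δ : ℝ} (hδ : 0 < δ) :
    ∫ x, |rieszPiece (Module.finrank ℝ E) e δ x| ∂μ ≤
      2 * 2 ^ Module.finrank ℝ E * μ.real (closedBall 0 1) := by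
  refine (integral_abs_le_of_support_subset_closedBall (by positivity)
    (abs_rieszPiece_le _ he hδ) (fun x hx => rieszPiece_eq_zero _ _ hδ hx)).trans_eq ?_
  rw [mul_pow]
  field_simp

lemma integral_abs_rieszPiece_sub_le {e : E} (he : ‖e‖ ≤ 1) {δ : ℝ} (hδ : 0 < δ) {x : E}
    (hx : ‖x‖ ≤ 2 * δ) :
    ∫ y, |rieszPiece (Module.finrank ℝ E) e δ (-x + y)
        - rieszPiece (Module.finrank ℝ E) e δ y| ∂μ ≤
      2 * (Module.finrank ℝ E + 2) * 4 ^ Module.finrank ℝ E * μ.real (closedBall 0 1)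
        * (‖x‖ / δ) := by
  refine (integral_abs_le_of_support_subset_closedBall (R := 4 * δ) (by positivity)
    (C := 2 * (Module.finrank ℝ E + 2) * ‖x‖ * (δ ^ (Module.finrank ℝ E + 1))⁻¹)
    (fun y => ?_) (fun y hy => ?_)).trans_eq ?_
  · refine (abs_rieszPiece_sub_le _ he hδ _ _).trans_eq ?_
    simp
  · rw [rieszPiece_eq_zero _ _ hδ, rieszPiece_eq_zero _ _ hδ, sub_zero]
    · linarith
    · have := norm_sub_norm_le y x
      rw [neg_add_eq_sub]
      linarith
  · rw [mul_pow]
    field_simp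
    ring

lemma integral_rieszPiece (n : ℕ) (e : E) (δ : ℝ) :
    ∫ x, rieszPiece n e δ x ∂μ = 0 := by
  have h := integral_neg_eq_self (rieszPiece n e δ) μ
  simp only [rieszPiece_neg, integral_neg] at h
  linarith

end Kernel

lemma sum_pow_natDist_le {ρ : ℝ} (h0 : 0 ≤ ρ) (h1 : ρ < 1) (i N : ℕ) :
    ∑ j ∈ Finset.range N, ρ ^ (Nat.dist i j) ≤ 2 * (1 - ρ)⁻¹ := by
  have hgeom : ∀ m, ∑ j ∈ Finset.range m, ρ ^ j ≤ (1 - ρ)⁻¹ := fun m => by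
    rw [← tsum_geometric_of_lt_one h0 h1]
    exact (summable_geometric_of_lt_one h0 h1).sum_le_tsum _ fun _ _ => by positivity
  calc ∑ j ∈ Finset.range N, ρ ^ (Nat.dist i j)
      ≤ ∑ j ∈ Finset.range (i + N), ρ ^ (Nat.dist i j) :=
        Finset.sum_le_sum_of_subset_of_nonneg (Finset.range_mono (by omega))
          fun _ _ _ => by positivity
    _ = ∑ j ∈ Finset.range i, ρ ^ (Nat.dist i j) + ∑ j ∈ Finset.range N, ρ ^ j := by
        rw [Finset.sum_range_add]
        congr 1
        refine Finset.sum_congr rfl fun j _ => ?_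
        congr 1
        simp [Nat.dist]
    _ ≤ ∑ j ∈ Finset.range i, ρ ^ (i - 1 - j) + ∑ j ∈ Finset.range N, ρ ^ j := by
        refine add_le_add_left (Finset.sum_le_sum fun j hj => ?_) _
        refine pow_le_pow_of_le_one h0 h1.le ?_
        simp only [Nat.dist]
        omega
    _ ≤ 2 * (1 - ρ)⁻¹ := by
        rw [Finset.sum_range_reflect (fun j => ρ ^ j) i]
        linarith [hgeom i, hgeom N]

section Multiscale

variable {E : Type*} [NormedAddCommGroup E] [InnerProductSpace ℝ E] [FiniteDimensional ℝ E]
  [MeasurableSpace E] [BorelSpace E]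
  {H : Type*} [NormedAddCommGroup H] [InnerProductSpace ℝ H] [CompleteSpace H]

/-- The sum of the operators associated with the dyadic pieces of the Riesz kernel is bounded
uniformly in the number of pieces and in the smallest scale. -/
lemma exists_norm_sum_integralOp_le (μ : Measure E) [μ.IsAddHaarMeasure] :
    ∃ B : ℝ, 0 < B ∧ ∀ (U : E → H →ₗᵢ[ℝ] H) (hU : ∀ v, Continuous fun x => U x v),
      (∀ x y v, U (x + y) v = U x (U y v)) → (∀ v, U 0 v = v) →
      ∀ e : E, ‖e‖ ≤ 1 → ∀ δ : ℝ, 0 < δ → ∀ (N : ℕ) (T : ℕ → H →L[ℝ] H),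
      (∀ (k : ℕ) (hk : Integrable (rieszPiece (Module.finrank ℝ E) e (2 ^ k * δ)) μ),
        T k = integralOp μ U hU hk) →
      ‖∑ k ∈ Finset.range N, T k‖ ≤ B := by
  set n := Module.finrank ℝ E with hn
  set V := μ.real (closedBall (0 : E) 1) with hV
  have hV0 : 0 < V := ENNReal.toReal_pos
    (measure_closedBall_pos μ 0 one_pos).ne' measure_closedBall_lt_top.ne
  set D : ℝ := 2 * 2 ^ n * V * (2 * (n + 2) * 4 ^ n * V * 2) with hD
  have hD0 : 0 < D := by positivity
  have hρ0 : 0 ≤ √(1 / 2 : ℝ) := Real.sqrt_nonneg _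
  have hρ1 : √(1 / 2 : ℝ) < 1 := by
    rw [Real.sqrt_lt' one_pos]; norm_num
  have hρ2 : 0 < (1 - √(1 / 2 : ℝ))⁻¹ := inv_pos.2 (by linarith)
  refine ⟨√D * (2 * (1 - √(1 / 2 : ℝ))⁻¹), by positivity, ?_⟩
  intro U hU hadd hzero e he δ hδ N T hT
  have hδk : ∀ k : ℕ, 0 < 2 ^ k * δ := fun k => by positivity
  have h_int : ∀ k : ℕ, Integrable (rieszPiece n e (2 ^ k * δ)) μ :=
    fun k => integrable_rieszPiece n e (hδk k)
  have hstar : ∀ k, star (T k) = -T k := fun k => by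
    rw [hT k (h_int k)]
    exact star_integralOp U hU hadd hzero _ (rieszPiece_neg n e _)
  have hle : ∀ i j : ℕ, i ≤ j → ‖T i * T j‖ ≤ D * (1 / 2) ^ (j - i) := by
    intro i j hij
    rw [hT i (h_int i), hT j (h_int j)]
    have hpow : (2 : ℝ) ^ j = 2 ^ i * 2 ^ (j - i) := by rw [← pow_add]; congr 1; omega
    refine (norm_integralOp_mul_le U hU hadd (h_int i) (h_int j) (integral_rieszPiece n e _)
      (η := 2 * (n + 2) * 4 ^ n * V * (2 * (2 ^ i * δ) / (2 ^ j * δ))) (by positivity)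
      (integral_abs_rieszPiece_le he (hδk i)) ?_).trans_eq ?_
    · intro x hx
      have hx2 : ‖x‖ ≤ 2 * (2 ^ i * δ) := by
        by_contra! h
        exact hx (rieszPiece_eq_zero n e (hδk i) h)
      refine (integral_abs_rieszPiece_sub_le he (hδk j) (hx2.trans ?_)).trans ?_
      · gcongr
        norm_num
      · gcongr
    · rw [hD, hpow, one_div, inv_pow]
      field_simp
      rw [← hn, ← hV]
      ring
  have hall : ∀ i j : ℕ, ‖T i * T j‖ ≤ D * (1 / 2) ^ (Nat.dist i j) := by
    intro i j
    rcases le_total i j with h | h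
    · rw [Nat.dist_eq_sub_of_le h]
      exact hle i j h
    · rw [Nat.dist_eq_sub_of_le_right h, ← norm_star, star_mul, hstar, hstar, neg_mul_neg]
      exact hle j i h
  rw [← Fin.sum_univ_eq_sum_range]
  refine norm_sum_le_of_almost_orthogonal (fun k : Fin N => T k)
    (fun i j => √D * √(1 / 2 : ℝ) ^ (Nat.dist i j)) _ (fun i => hstar i) (fun i j => by positivity)
    (fun i j => ?_) (by positivity) (fun i => ?_)
  · rw [mul_pow, Real.sq_sqrt hD0.le, ← pow_mul, mul_comm _ 2, pow_mul,
      Real.sq_sqrt (by norm_num)]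
    exact hall i j
  · rw [← Finset.mul_sum, Fin.sum_univ_eq_sum_range (fun j => √(1 / 2 : ℝ) ^ (Nat.dist i j))]
    gcongr
    exact sum_pow_natDist_le hρ0 hρ1 _ _

end Multiscale

lemma inner_toLp {α : Type*} [MeasurableSpace α] {μ : Measure α} {f g : α → ℝ}
    (hf : MemLp f 2 μ) (hg : MemLp g 2 μ) :
    inner ℝ (hf.toLp f) (hg.toLp g) = ∫ x, g x * f x ∂μ := by
  rw [L2.inner_def]
  refine integral_congr_ae ?_
  filter_upwards [hf.coeFn_toLp, hg.coeFn_toLp] with x h1 h2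
  rw [h1, h2]
  rfl

section Translation

variable {E : Type*} [NormedAddCommGroup E] [MeasurableSpace E] [BorelSpace E]

/-- Translation by `w` as an isometry of `L²(μ)`. -/
noncomputable def translationL2 (μ : Measure E) [μ.IsAddHaarMeasure] (w : E) :
    Lp ℝ 2 μ →ₗᵢ[ℝ] Lp ℝ 2 μ :=
  Lp.compMeasurePreservingₗᵢ ℝ (fun x => x - w) (measurePreserving_sub_right μ w)

variable {μ : Measure E} [μ.IsAddHaarMeasure]

lemma translationL2_toLp (w : E) {f : E → ℝ} (hf : MemLp f 2 μ) :
    translationL2 μ w (hf.toLp f) =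
      (hf.comp_measurePreserving (measurePreserving_sub_right μ w)).toLp (fun x => f (x - w)) :=
  rfl

lemma continuous_translationL2 [IsLocallyFiniteMeasure μ] [μ.InnerRegularCompactLTTop]
    (v : Lp ℝ 2 μ) :
    Continuous fun w => translationL2 μ w v :=
  let g : C(E, C(E, E)) := (ContinuousMap.mk (fun p : E × E => p.2 - p.1) (by fun_prop)).curry
  (continuous_const (y := v)).compMeasurePreservingLp g.continuous
    (fun w => measurePreserving_sub_right μ w) (by norm_num)

lemma translationL2_add (x y : E) (v : Lp ℝ 2 μ) :
    translationL2 μ (x + y) v = translationL2 μ x (translationL2 μ y v) := by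
  obtain ⟨f, hf, rfl⟩ : ∃ f, ∃ hf : MemLp f 2 μ, hf.toLp f = v :=
    ⟨v, Lp.memLp v, Lp.toLp_coeFn _ _⟩
  simp only [translationL2_toLp, sub_add_eq_sub_sub]

lemma translationL2_zero (v : Lp ℝ 2 μ) : translationL2 μ 0 v = v := by
  obtain ⟨f, hf, rfl⟩ : ∃ f, ∃ hf : MemLp f 2 μ, hf.toLp f = v :=
    ⟨v, Lp.memLp v, Lp.toLp_coeFn _ _⟩
  simp only [translationL2_toLp, sub_zero]

end Translation

section KernelIntegral

variable {E : Type*} [NormedAddCommGroup E] [InnerProductSpace ℝ E]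
  [MeasurableSpace E] {μ : Measure E}

lemma integrable_rieszKernel_mul [BorelSpace E] (n : ℕ) {e : E}
    (he : ‖e‖ ≤ 1) {δ : ℝ} (hδ : 0 < δ)
    {f : E → ℝ} (hf : Integrable f μ) (x : E) :
    Integrable (fun y => rieszKernel n e δ (x - y) * f y) μ :=
  hf.bdd_mul (((continuous_rieszKernel n e hδ).comp
      (continuous_const.sub continuous_id)).aestronglyMeasurable)
    (c := (δ ^ n)⁻¹) (ae_of_all _ fun _ => abs_rieszKernel_le n he hδ _)

lemma abs_integral_rieszKernel_mul_le (n : ℕ) {e : E} (he : ‖e‖ ≤ 1) {δ : ℝ} (hδ : 0 < δ)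
    {f : E → ℝ} (hf : Integrable f μ) (x : E) :
    |∫ y, rieszKernel n e δ (x - y) * f y ∂μ| ≤ (δ ^ n)⁻¹ * ∫ y, |f y| ∂μ := by
  rw [← integral_const_mul]
  refine norm_integral_le_of_norm_le (f := fun y => rieszKernel n e δ (x - y) * f y)
    (hf.abs.const_mul _) (ae_of_all _ fun y => ?_)
  rw [norm_mul]
  exact mul_le_mul_of_nonneg_right (abs_rieszKernel_le n he hδ _) (abs_nonneg _)

lemma continuous_integral_rieszKernel_mul [BorelSpace E] (n : ℕ) {e : E}
    (he : ‖e‖ ≤ 1) {δ : ℝ} (hδ : 0 < δ)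
    {f : E → ℝ} (hf : Integrable f μ) :
    Continuous fun x => ∫ y, rieszKernel n e δ (x - y) * f y ∂μ := by
  refine continuous_of_dominated (bound := fun y => (δ ^ n)⁻¹ * |f y|)
    (fun x => (integrable_rieszKernel_mul n he hδ hf x).aestronglyMeasurable)
    (fun x => ae_of_all _ fun y => ?_) (hf.abs.const_mul _) (ae_of_all _ fun y => ?_)
  · rw [norm_mul]
    exact mul_le_mul_of_nonneg_right (abs_rieszKernel_le n he hδ _) (abs_nonneg _)
  · exact ((continuous_rieszKernel n e hδ).comp (continuous_id.sub continuous_const)).mul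
      continuous_const

end KernelIntegral

section Pairing

variable {E : Type*} [NormedAddCommGroup E] [InnerProductSpace ℝ E] [FiniteDimensional ℝ E]
  [MeasurableSpace E] [BorelSpace E] {μ : Measure E} [μ.IsAddHaarMeasure]

lemma inner_integralOp_toLp {k f g : E → ℝ} (hk : Integrable k μ) (hf : MemLp f 2 μ)
    (hf1 : Integrable f μ) (hg : MemLp g 2 μ) {G : ℝ} (hG : ∀ x, |g x| ≤ G) :
    inner ℝ (integralOp μ (translationL2 μ) continuous_translationL2 hk (hf.toLp f)) (hg.toLp g)
      = ∫ x, g x * ∫ y, k (x - y) * f y ∂μ ∂μ := by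
  rw [real_inner_comm, integralOp_apply, ← integral_inner
    (integrable_smul_isometry hk _ continuous_translationL2 _)]
  have h1 : ∀ w, inner ℝ (hg.toLp g) (k w • translationL2 μ w (hf.toLp f))
      = ∫ x, g x * (k w * f (x - w)) ∂μ := by
    intro w
    rw [inner_smul_right, real_inner_comm, translationL2_toLp, inner_toLp, ← integral_const_mul]
    exact integral_congr_ae (ae_of_all _ fun x => by ring)
  simp only [h1]
  have h_int : Integrable (fun p : E × E => k p.2 * f (p.1 - p.2)) (μ.prod μ) :=
    hk.convolution_integrand (ContinuousLinearMap.mul ℝ ℝ) hf1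
  rw [← integral_integral_swap (f := fun x w => g x * (k w * f (x - w)))]
  · refine integral_congr_ae (ae_of_all _ fun x => ?_)
    simp only [integral_const_mul]
    congr 1
    rw [← integral_sub_left_eq_self _ μ x]
    simp
  · refine Integrable.bdd_mul h_int ?_ (c := G) (ae_of_all _ fun p => hG p.1)
    exact hg.aestronglyMeasurable.comp_fst

/-- Uniform `L²` bound for the regularized scalar Riesz kernels on a Euclidean space. -/
lemma exists_setLIntegral_rieszKernel_sq_le (μ : Measure E) [μ.IsAddHaarMeasure]
    (hn : Module.finrank ℝ E ≠ 0) :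
    ∃ C : ℝ, 0 < C ∧ ∀ e : E, ‖e‖ ≤ 1 → ∀ ε : ℝ, 0 < ε → ∀ S : Set E, MeasurableSet S → μ S ≠ ∞ →
      ∀ f : E → ℝ, MemLp f 2 μ → Integrable f μ →
      ∫⁻ x in S, ENNReal.ofReal
          ((∫ y, rieszKernel (Module.finrank ℝ E) e ε (x - y) * f y ∂μ) ^ 2) ∂μ
        ≤ ENNReal.ofReal C * ∫⁻ x, ENNReal.ofReal (f x ^ 2) ∂μ := by
  obtain ⟨B, hB0, hB⟩ := exists_norm_sum_integralOp_le (H := Lp ℝ 2 μ) μ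
  refine ⟨B ^ 2, by positivity, ?_⟩
  intro e he ε hε S hS hSμ f hf hf1
  set n := Module.finrank ℝ E with hn'
  set F : ℝ → E → ℝ := fun δ x => ∫ y, rieszKernel n e δ (x - y) * f y ∂μ with hF
  have hkint : ∀ δ, 0 < δ → ∀ x, Integrable (fun y => rieszKernel n e δ (x - y) * f y) μ :=
    fun δ hδ x => integrable_rieszKernel_mul n he hδ hf1 x
  have hFbd : ∀ δ, 0 < δ → ∀ x, |F δ x| ≤ (δ ^ n)⁻¹ * ∫ y, |f y| ∂μ :=
    fun δ hδ x => abs_integral_rieszKernel_mul_le n he hδ hf1 x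
  have hFmeas : ∀ δ, 0 < δ → Continuous (F δ) :=
    fun δ hδ => continuous_integral_rieszKernel_mul n he hδ hf1
  set g : E → ℝ := S.indicator (F ε) with hg
  set G : ℝ := (ε ^ n)⁻¹ * ∫ y, |f y| ∂μ with hGdef
  have hG0 : 0 ≤ G := by positivity
  have hG : ∀ x, |g x| ≤ G := fun x => by
    by_cases hx : x ∈ S
    · simpa [hg, hx] using hFbd ε hε x
    · simpa [hg, hx] using hG0
  have hgmemp : ∀ p, MemLp g p μ := by
    intro p
    rw [hg, memLp_indicator_iff_restrict hS]
    have : IsFiniteMeasure (μ.restrict S) := ⟨by simpa using hSμ.lt_top⟩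
    exact MemLp.of_bound (hFmeas ε hε).aestronglyMeasurable G (ae_of_all _ (hFbd ε hε))
  have hg2 : MemLp g 2 μ := hgmemp 2
  have hg1 : Integrable g μ := memLp_one_iff_integrable.1 (hgmemp 1)
  have hgF : ∫ x in S, F ε x ^ 2 ∂μ = ∫ x, g x * F ε x ∂μ := by
    rw [← integral_indicator hS]
    refine integral_congr_ae (ae_of_all _ fun x => ?_)
    by_cases hx : x ∈ S <;> simp [hg, hx, sq]
  have hgg : ∫ x in S, F ε x ^ 2 ∂μ = ‖hg2.toLp g‖ ^ 2 := by
    rw [← real_inner_self_eq_norm_sq, inner_toLp, ← integral_indicator hS]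
    refine integral_congr_ae (ae_of_all _ fun x => ?_)
    by_cases hx : x ∈ S <;> simp [hg, hx, sq]
  have hff : ∫ x, f x ^ 2 ∂μ = ‖hf.toLp f‖ ^ 2 := by
    rw [← real_inner_self_eq_norm_sq, inner_toLp]
    exact integral_congr_ae (ae_of_all _ fun x => by ring)
  have hmain : ∀ N : ℕ, ∫ x, g x * F ε x ∂μ ≤ B * ‖hf.toLp f‖ * ‖hg2.toLp g‖
      + ((2 ^ N * ε) ^ n)⁻¹ * ((∫ y, |f y| ∂μ) * ∫ x, |g x| ∂μ) := by
    intro N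
    have hk : ∀ k : ℕ, Integrable (rieszPiece n e (2 ^ k * ε)) μ :=
      fun k => integrable_rieszPiece n e (by positivity)
    set T : ℕ → Lp ℝ 2 μ →L[ℝ] Lp ℝ 2 μ :=
      fun k => integralOp μ (translationL2 μ) continuous_translationL2 (hk k) with hT
    have hTB : ‖∑ k ∈ Finset.range N, T k‖ ≤ B :=
      hB _ continuous_translationL2 translationL2_add translationL2_zero e he ε hε N T
        fun k _ => rfl
    have hpieceF : ∀ k : ℕ, ∀ x, ∫ y, rieszPiece n e (2 ^ k * ε) (x - y) * f y ∂μ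
        = F (2 ^ k * ε) x - F (2 ^ (k + 1) * ε) x := by
      intro k x
      rw [hF]
      simp only
      rw [← integral_sub (hkint _ (by positivity) x) (hkint _ (by positivity) x)]
      refine integral_congr_ae (ae_of_all _ fun y => ?_)
      simp only [rieszPiece, pow_succ', mul_assoc, sub_mul]
    have hgFint : ∀ k : ℕ, Integrable (fun x => g x * F (2 ^ k * ε) x) μ := fun k =>
      hg1.mul_bdd (hFmeas _ (by positivity)).aestronglyMeasurable
        (ae_of_all _ (hFbd _ (by positivity)))
    have hinner : inner ℝ ((∑ k ∈ Finset.range N, T k) (hf.toLp f)) (hg2.toLp g)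
        = ∫ x, g x * F ε x ∂μ - ∫ x, g x * F (2 ^ N * ε) x ∂μ := by
      rw [sum_apply, sum_inner]
      calc _ = ∑ k ∈ Finset.range N,
            (∫ x, g x * F (2 ^ k * ε) x ∂μ - ∫ x, g x * F (2 ^ (k + 1) * ε) x ∂μ) := by
            refine Finset.sum_congr rfl fun k _ => ?_
            rw [hT]
            simp only
            rw [inner_integralOp_toLp (hk k) hf hf1 hg2 hG,
              ← integral_sub (hgFint k) (hgFint (k + 1))]
            refine integral_congr_ae (ae_of_all _ fun x => ?_)
            simp only [hpieceF, mul_sub]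
        _ = _ := by
            rw [Finset.sum_range_sub' (fun k : ℕ => ∫ x, g x * F (2 ^ k * ε) x ∂μ)]
            simp
    have hle1 : inner ℝ ((∑ k ∈ Finset.range N, T k) (hf.toLp f)) (hg2.toLp g)
        ≤ B * ‖hf.toLp f‖ * ‖hg2.toLp g‖ := by
      refine (real_inner_le_norm _ _).trans ?_
      gcongr
      exact ContinuousLinearMap.le_of_opNorm_le _ hTB _
    have hle2 : ∫ x, g x * F (2 ^ N * ε) x ∂μ
        ≤ ((2 ^ N * ε) ^ n)⁻¹ * ((∫ y, |f y| ∂μ) * ∫ x, |g x| ∂μ) := by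
      rw [← mul_assoc, ← integral_const_mul]
      refine integral_mono (hgFint N) (hg1.abs.const_mul _) fun x => ?_
      simp only
      refine (le_abs_self _).trans ?_
      rw [abs_mul, mul_comm]
      gcongr
      exact hFbd _ (by positivity) x
    linarith
  have hlim : Tendsto (fun N : ℕ => B * ‖hf.toLp f‖ * ‖hg2.toLp g‖
      + ((2 ^ N * ε) ^ n)⁻¹ * ((∫ y, |f y| ∂μ) * ∫ x, |g x| ∂μ)) atTop
      (𝓝 (B * ‖hf.toLp f‖ * ‖hg2.toLp g‖ + 0 * ((∫ y, |f y| ∂μ) * ∫ x, |g x| ∂μ))) := by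
    refine (Tendsto.mul_const _ ?_).const_add _
    refine tendsto_inv_atTop_zero.comp ((tendsto_pow_atTop hn).comp ?_)
    exact (tendsto_pow_atTop_atTop_of_one_lt one_lt_two).atTop_mul_const hε
  have hfin := ge_of_tendsto' hlim hmain
  rw [zero_mul, add_zero, ← hgF, hgg] at hfin
  change ∫⁻ x in S, ENNReal.ofReal (F ε x ^ 2) ∂μ ≤ _
  have hFS : IntegrableOn (fun x => F ε x ^ 2) S μ :=
    ((memLp_indicator_iff_restrict hS).1 hg2).integrable_sq
  rw [← ofReal_integral_eq_lintegral_ofReal hFS (ae_of_all _ fun x => sq_nonneg _),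
    ← ofReal_integral_eq_lintegral_ofReal hf.integrable_sq (ae_of_all _ fun x => sq_nonneg _),
    ← ENNReal.ofReal_mul (by positivity), hgg, hff, ← mul_pow]
  have hle : ‖hg2.toLp g‖ ≤ B * ‖hf.toLp f‖ := by
    by_contra! h
    have : 0 ≤ B * ‖hf.toLp f‖ := by positivity
    nlinarith
  gcongr

end Pairing

section Plane

instance isAddHaarMeasure_hausdorffMeasure_euc (n : ℕ) :
    (μH[(n : ℝ)] : Measure (Euc n)).IsAddHaarMeasure := by
  simpa using isAddHaarMeasure_hausdorffMeasure (E := Euc n)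

lemma integrable_regRiesz_integrand (n : ℕ) {d : ℕ} {μ : Measure (Euc d)} {ε : ℝ} (hε : 0 < ε)
    {f : Euc d → ℝ} (hf : Integrable f μ) (x : Euc d) :
    Integrable (fun y => ((max ‖x - y‖ ε) ^ (n + 1))⁻¹ • f y • (x - y)) μ := by
  refine (hf.norm.const_mul ((ε ^ n)⁻¹)).mono' ?_ (ae_of_all _ fun y => ?_)
  · have h1 : Measurable fun y : Euc d => ((max ‖x - y‖ ε) ^ (n + 1))⁻¹ :=
      ((((measurable_const.sub measurable_id).norm).max measurable_const).pow_const _).inv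
    have h2 : Continuous fun y : Euc d => x - y := by fun_prop
    exact h1.aestronglyMeasurable.smul (hf.aestronglyMeasurable.smul h2.aestronglyMeasurable)
  · have hm0 : 0 < max ‖x - y‖ ε := hε.trans_le (le_max_right _ _)
    rw [norm_smul, norm_smul, norm_inv, norm_pow, Real.norm_of_nonneg hm0.le]
    calc (max ‖x - y‖ ε ^ (n + 1))⁻¹ * (‖f y‖ * ‖x - y‖)
        ≤ (max ‖x - y‖ ε ^ (n + 1))⁻¹ * (‖f y‖ * max ‖x - y‖ ε) := by
          gcongr
          exact le_max_left _ _
      _ = (max ‖x - y‖ ε ^ n)⁻¹ * ‖f y‖ := by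
          rw [pow_succ, mul_inv]
          field_simp
      _ ≤ (ε ^ n)⁻¹ * ‖f y‖ := by
          gcongr
          exact le_max_right _ _

lemma inner_regRiesz (n : ℕ) {d : ℕ} {μ : Measure (Euc d)} {ε : ℝ} (hε : 0 < ε)
    {f : Euc d → ℝ} (hf : Integrable f μ) (e x : Euc d) :
    inner ℝ e (regRiesz n μ ε f x) = ∫ y, rieszKernel n e ε (x - y) * f y ∂μ := by
  rw [regRiesz, ← integral_inner (integrable_regRiesz_integrand n hε hf x)]
  refine integral_congr_ae (ae_of_all _ fun y => ?_)
  simp only [inner_smul_right, rieszKernel]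
  ring

/-- The regularized Riesz transform is bounded in `L²` on a Euclidean space of the same
dimension. -/
lemma exists_setLIntegral_regRiesz_le (n : ℕ) (μ : Measure (Euc n)) [μ.IsAddHaarMeasure] :
    ∃ C : ℝ, 0 < C ∧ ∀ ε : ℝ, 0 < ε → ∀ S : Set (Euc n), MeasurableSet S → μ S ≠ ∞ →
      ∀ f : Euc n → ℝ, MemLp f 2 μ → Integrable f μ →
      ∫⁻ x in S, (‖regRiesz n μ ε f x‖₊ : ℝ≥0∞) ^ 2 ∂μ ≤
        ENNReal.ofReal C * ∫⁻ x, (‖f x‖₊ : ℝ≥0∞) ^ 2 ∂μ := by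
  rcases Nat.eq_zero_or_pos n with rfl | hn
  · refine ⟨1, one_pos, fun ε _ S _ _ f _ _ => ?_⟩
    have h : ∀ x, regRiesz 0 μ ε f x = 0 := fun x => Subsingleton.elim _ _
    simp [h]
  obtain ⟨C, hC0, hC⟩ := exists_setLIntegral_rieszKernel_sq_le μ (by simpa using hn.ne')
  simp only [finrank_euclideanSpace, Fintype.card_fin] at hC
  refine ⟨n * C, by positivity, ?_⟩
  intro ε hε S hS hSμ f hf hf1
  let e : Fin n → Euc n := fun i => EuclideanSpace.single i 1
  have he1 : ∀ i, ‖e i‖ ≤ 1 := fun i => by simp [e]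
  have hcoord : ∀ x i, regRiesz n μ ε f x i = ∫ y, rieszKernel n (e i) ε (x - y) * f y ∂μ := by
    intro x i
    rw [← inner_regRiesz n hε hf1]
    simp [e, EuclideanSpace.inner_single_left]
  have hnorm : ∀ x, (‖regRiesz n μ ε f x‖₊ : ℝ≥0∞) ^ 2
      = ∑ i, ENNReal.ofReal ((∫ y, rieszKernel n (e i) ε (x - y) * f y ∂μ) ^ 2) := by
    intro x
    rw [← ENNReal.ofReal_sum_of_nonneg fun i _ => sq_nonneg _, ← enorm_eq_nnnorm, ← ofReal_norm,
      ← ENNReal.ofReal_pow (norm_nonneg _), EuclideanSpace.norm_sq_eq]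
    simp only [hcoord, Real.norm_eq_abs, sq_abs]
  have hfn : ∀ x, (‖f x‖₊ : ℝ≥0∞) ^ 2 = ENNReal.ofReal (f x ^ 2) := by
    intro x
    rw [← enorm_eq_nnnorm, ← ofReal_norm, ← ENNReal.ofReal_pow (norm_nonneg _), Real.norm_eq_abs,
      sq_abs]
  simp only [hnorm, hfn]
  rw [lintegral_finsetSum _ fun i _ => ((continuous_integral_rieszKernel_mul n (he1 i) hε
    hf1).measurable.pow_const 2).ennreal_ofReal]
  refine (Finset.sum_le_sum fun i _ => hC (e i) (he1 i) ε hε S hS hSμ f hf hf1).trans_eq ?_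
  rw [Finset.sum_const, Finset.card_univ, Fintype.card_fin, nsmul_eq_mul,
    ENNReal.ofReal_mul (by positivity), ENNReal.ofReal_natCast, mul_assoc]

lemma IsAffineNPlane.exists_isometry {n d : ℕ} {W : Set (Euc d)} (hW : IsAffineNPlane n W) :
    ∃ (a : Euc d) (L : Euc n →ₗᵢ[ℝ] Euc d), range (fun u => a + L u) = W := by
  obtain ⟨a, V, hV, rfl⟩ := hW
  set b := (stdOrthonormalBasis ℝ V).reindex (finCongr hV)
  refine ⟨a, V.subtypeₗᵢ.comp b.repr.symm.toLinearIsometry, ?_⟩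
  ext z
  simp only [mem_range, mem_image]
  constructor
  · rintro ⟨u, rfl⟩
    exact ⟨_, (b.repr.symm u).2, rfl⟩
  · rintro ⟨v, hv, rfl⟩
    exact ⟨b.repr ⟨v, hv⟩, by simp⟩

lemma regRiesz_indicator (n : ℕ) {d : ℕ} (μ : Measure (Euc d)) (ε : ℝ) {S : Set (Euc d)}
    (hS : MeasurableSet S) (f : Euc d → ℝ) (x : Euc d) :
    regRiesz n μ ε (S.indicator f) x = regRiesz n (μ.restrict S) ε f x := by
  rw [regRiesz, regRiesz, ← integral_indicator hS]
  refine integral_congr_ae (ae_of_all _ fun y => ?_)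
  by_cases hy : y ∈ S <;> simp [hy]

/-- The regularized Riesz transform is bounded in `L²` on the intersection of an `n`-plane with a
closed ball, uniformly in the plane and the ball. -/
lemma exists_lintegral_regRiesz_plane_le (d n : ℕ) :
    ∃ C : ℝ, 0 < C ∧ ∀ W : Set (Euc d), IsAffineNPlane n W → ∀ (x : Euc d) (r : ℝ),
      ∀ ε : ℝ, 0 < ε → ∀ f : Euc d → ℝ, Measurable f →
      ∫⁻ z, (‖regRiesz n (μH[(n : ℝ)].restrict (W ∩ closedBall x r)) ε f z‖₊ : ℝ≥0∞) ^ 2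
          ∂(μH[(n : ℝ)].restrict (W ∩ closedBall x r))
        ≤ ENNReal.ofReal C *
          ∫⁻ z, (‖f z‖₊ : ℝ≥0∞) ^ 2 ∂(μH[(n : ℝ)].restrict (W ∩ closedBall x r)) := by
  obtain ⟨C, hC0, hC⟩ := exists_setLIntegral_regRiesz_le n μH[(n : ℝ)]
  refine ⟨C, hC0, ?_⟩
  intro W hW x r ε hε f hf
  obtain ⟨a, L, rfl⟩ := hW.exists_isometry
  set φ : Euc n → Euc d := fun u => a + L u with hφ
  have hφi : Isometry φ := fun u v => by simp [hφ, L.isometry.edist_eq]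
  have hφe : MeasurableEmbedding φ := hφi.isClosedEmbedding.measurableEmbedding
  set S : Set (Euc n) := φ ⁻¹' closedBall x r with hS
  have hSm : MeasurableSet S := hφi.continuous.measurable measurableSet_closedBall
  have hSμ : μH[(n : ℝ)] S ≠ ∞ :=
    (hφi.isClosedEmbedding.isCompact_preimage (isCompact_closedBall x r)).measure_lt_top.ne
  have hν : (μH[(n : ℝ)] : Measure (Euc d)).restrict (range φ ∩ closedBall x r)
      = Measure.map φ (μH[(n : ℝ)].restrict S) := by
    rw [inter_comm, ← Measure.restrict_restrict measurableSet_closedBall,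
      ← hφi.map_hausdorffMeasure (Or.inl n.cast_nonneg),
      Measure.restrict_map hφi.continuous.measurable measurableSet_closedBall]
  rw [hν, hφe.lintegral_map, hφe.lintegral_map]
  have hreg : ∀ u, ‖regRiesz n (Measure.map φ (μH[(n : ℝ)].restrict S)) ε f (φ u)‖₊
      = ‖regRiesz n μH[(n : ℝ)] ε (S.indicator (f ∘ φ)) u‖₊ := by
    intro u
    rw [regRiesz_indicator _ _ _ hSm, ← L.nnnorm_map]
    congr 1
    rw [regRiesz, regRiesz, hφe.integral_map, ← L.integral_comp_comm]
    refine integral_congr_ae (ae_of_all _ fun v => ?_)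
    have h1 : φ u - φ v = L (u - v) := by simp [hφ]
    simp only [h1, L.norm_map, map_smul, Function.comp_apply]
  simp only [hreg]
  by_cases hfin : ∫⁻ u in S, (‖f (φ u)‖₊ : ℝ≥0∞) ^ 2 ∂μH[(n : ℝ)] = ∞
  · rw [hfin, ENNReal.mul_top (by simpa using hC0)]
    exact le_top
  have hmem : MemLp (f ∘ φ) 2 (μH[(n : ℝ)].restrict S) := by
    refine ⟨(hf.comp hφi.continuous.measurable).aestronglyMeasurable, ?_⟩
    rw [eLpNorm_lt_top_iff_lintegral_rpow_enorm_lt_top (by norm_num) (by norm_num)]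
    simpa [enorm_eq_nnnorm] using lt_top_iff_ne_top.2 hfin
  have : IsFiniteMeasure ((μH[(n : ℝ)] : Measure (Euc n)).restrict S) :=
    ⟨by simpa using hSμ.lt_top⟩
  refine (hC ε hε S hSm hSμ (S.indicator (f ∘ φ)) ((memLp_indicator_iff_restrict hSm).2 hmem)
    ((integrable_indicator_iff hSm).2 (hmem.integrable (by norm_num)))).trans_eq ?_
  rw [← lintegral_indicator hSm]
  congr 1
  refine lintegral_congr fun u => ?_
  by_cases hu : u ∈ S <;> simp [hu]

end Plane

/-- The local operator `R^{loc}_{σ,ε} f(z) = R̃_{σ,ε}(f·χ_{B(z)})(z)` is bounded in `L²(σ)`,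
with constant depending only on `d` and `n` (independent of `ε` and of the family of balls),
where `σ = Σ_{x∈H} H^n⌊(Π_x ∩ B_x)` and the balls `2B_x` are pairwise disjoint. Its
`L²(σ)`-norm squared is written as a sum over the (disjoint) balls. -/
theorem local_operator_bounded (d n : ℕ) :
    ∃ c : ℝ, 0 < c ∧
    ∀ H : Set (Euc d), H.Countable →
    ∀ r : Euc d → ℝ, (∀ x ∈ H, 0 < r x) →
      H.PairwiseDisjoint (fun x => closedBall x (2 * r x)) →
    ∀ P : Euc d → Set (Euc d),
      (∀ x ∈ H, ∃ W : Set (Euc d), IsAffineNPlane n W ∧ x ∈ W ∧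
        P x = W ∩ closedBall x (r x)) →
    ∀ σ : Measure (Euc d),
      σ = Measure.sum (fun x : H => (μH[(n : ℝ)] : Measure (Euc d)).restrict (P x.1)) →
    ∀ ε : ℝ, 0 < ε → ∀ f : Euc d → ℝ, Measurable f →
      ∑' x : H, ∫⁻ z in closedBall x.1 (r x.1),
          (‖regRiesz n σ ε ((closedBall x.1 (r x.1)).indicator f) z‖₊ : ℝ≥0∞) ^ 2 ∂σ
        ≤ ENNReal.ofReal c * ∫⁻ z, (‖f z‖₊ : ℝ≥0∞) ^ 2 ∂σ := by
  obtain ⟨C, hC0, hC⟩ := exists_lintegral_regRiesz_plane_le d n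
  refine ⟨C, hC0, ?_⟩
  intro H _ r hr hdisj P hP σ hσ ε hε f hf
  have hσB : ∀ x : H, σ.restrict (closedBall x.1 (r x.1))
      = (μH[(n : ℝ)] : Measure (Euc d)).restrict (P x.1) := by
    intro x
    have hPB : ∀ y : H, P y.1 ⊆ closedBall y.1 (r y.1) := fun y => by
      obtain ⟨W, -, -, hW⟩ := hP y.1 y.2
      rw [hW]
      exact inter_subset_right
    rw [hσ, Measure.restrict_sum _ measurableSet_closedBall]
    ext s hs
    rw [Measure.sum_apply _ hs, tsum_eq_single x]
    · rw [Measure.restrict_restrict measurableSet_closedBall, inter_eq_self_of_subset_right (hPB x)]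
    · intro y hyx
      have h1 : closedBall x.1 (r x.1) ∩ P y.1 = ∅ := by
        have h2 := hdisj x.2 y.2 (fun h => hyx (Subtype.ext h.symm))
        refine (h2.mono (closedBall_subset_closedBall (by linarith [hr x.1 x.2]))
          ((hPB y).trans (closedBall_subset_closedBall (by linarith [hr y.1 y.2])))).inter_eq
      rw [Measure.restrict_restrict measurableSet_closedBall, h1]
      simp
  calc _ ≤ ∑' x : H, ENNReal.ofReal C *
        ∫⁻ z, (‖f z‖₊ : ℝ≥0∞) ^ 2 ∂(μH[(n : ℝ)] : Measure (Euc d)).restrict (P x.1) := by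
        refine ENNReal.tsum_le_tsum fun x => ?_
        obtain ⟨W, hW, -, hPW⟩ := hP x.1 x.2
        simp only [regRiesz_indicator n σ ε measurableSet_closedBall, hσB x]
        rw [hPW]
        exact hC W hW _ _ ε hε f hf
    _ = _ := by rw [ENNReal.tsum_mul_left, hσ, lintegral_sum_measure]
end

section
/- Let ν be a finite Borel measure on ℝ^d with growth of degree n, supported on the union of a countable family of closed balls {B_x}_{x∈H}, B_x centered at x with radius r(x), such that the doubled balls 2B_x are pairwise disjoint. For z ∈ ∪_x B_x let B(z) be the ball B_x containing z, and define T_ν f(z) = Σ_{x∈H: z∉B_x} [r(x)/dist(B(z), B_x)^{n+1}] ∫_{B_x} f dν. Then T_ν is bounded in L²(ν), with norm depending only on d, n and the growth constant of ν. -/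
open MeasureTheory Metric Set Filter
open scoped ENNReal NNReal Topology

/-- A finite `TT*` argument. -/
lemma sum_sq_le_of_compose_le {ι : Type*} [DecidableEq ι] (F : Finset ι) (m b e : ι → ℝ)
    (k : ι → ι → ℝ) (A E : ℝ) (hm : ∀ x ∈ F, 0 ≤ m x) (hb : ∀ x ∈ F, 0 ≤ b x)
    (hk : ∀ x ∈ F, ∀ y ∈ F, ∑ z ∈ F, m z * (k z x * k z y) ≤
      A * (k x y + k y x) + if x = y then e x else 0)
    (he : ∀ x ∈ F, m x * e x ≤ E) :
    ∑ z ∈ F, m z * (∑ x ∈ F, k z x * (m x * b x)) ^ 2 ≤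
      (4 * A ^ 2 + 2 * E) * ∑ x ∈ F, m x * b x ^ 2 := by
  set u : ι → ℝ := fun z => ∑ x ∈ F, k z x * (m x * b x) with hu
  have h1 : ∑ z ∈ F, m z * (u z) ^ 2 =
      ∑ x ∈ F, ∑ y ∈ F, (m x * b x) * (m y * b y) * ∑ z ∈ F, m z * (k z x * k z y) := by
    simp only [hu, sq, Finset.sum_mul_sum]
    simp only [Finset.mul_sum]
    rw [Finset.sum_comm]
    refine Finset.sum_congr rfl fun x _ => ?_
    rw [Finset.sum_comm]
    refine Finset.sum_congr rfl fun y _ => Finset.sum_congr rfl fun z _ => ?_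
    ring
  have h2 : ∑ z ∈ F, m z * (u z) ^ 2 ≤
      ∑ x ∈ F, ∑ y ∈ F, (m x * b x) * (m y * b y) *
        (A * (k x y + k y x) + if x = y then e x else 0) := by
    rw [h1]
    refine Finset.sum_le_sum fun x hx => Finset.sum_le_sum fun y hy => ?_
    exact mul_le_mul_of_nonneg_left (hk x hx y hy)
      (mul_nonneg (mul_nonneg (hm x hx) (hb x hx)) (mul_nonneg (hm y hy) (hb y hy)))
  have h3 : ∑ x ∈ F, ∑ y ∈ F, (m x * b x) * (m y * b y) *
        (A * (k x y + k y x) + if x = y then e x else 0) =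
      2 * A * ∑ x ∈ F, m x * b x * u x + ∑ x ∈ F, (m x * b x) ^ 2 * e x := by
    have hs : ∑ x ∈ F, ∑ y ∈ F, (m x * b x) * (m y * b y) * (A * k y x) =
        A * ∑ x ∈ F, m x * b x * u x := by
      rw [Finset.sum_comm]
      simp only [hu, Finset.mul_sum]
      exact Finset.sum_congr rfl fun x _ => Finset.sum_congr rfl fun y _ => by ring
    have hs' : ∑ x ∈ F, ∑ y ∈ F, (m x * b x) * (m y * b y) * (A * k x y) =
        A * ∑ x ∈ F, m x * b x * u x := by
      simp only [hu, Finset.mul_sum]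
      exact Finset.sum_congr rfl fun x _ => Finset.sum_congr rfl fun y _ => by ring
    have hd : ∑ x ∈ F, ∑ y ∈ F, (m x * b x) * (m y * b y) * (if x = y then e x else 0) =
        ∑ x ∈ F, (m x * b x) ^ 2 * e x := by
      refine Finset.sum_congr rfl fun x hx => ?_
      simp [hx, sq]
    simp only [mul_add, Finset.sum_add_distrib]
    rw [hs, hs', hd]
    ring
  have h4 : 2 * A * ∑ x ∈ F, m x * b x * u x ≤
      (1 / 2) * ∑ z ∈ F, m z * (u z) ^ 2 + 2 * A ^ 2 * ∑ x ∈ F, m x * b x ^ 2 := by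
    rw [Finset.mul_sum, Finset.mul_sum, Finset.mul_sum, ← Finset.sum_add_distrib]
    refine Finset.sum_le_sum fun x hx => ?_
    have := mul_nonneg (hm x hx) (sq_nonneg (u x - 2 * A * b x))
    nlinarith
  have h5 : ∑ x ∈ F, (m x * b x) ^ 2 * e x ≤ E * ∑ x ∈ F, m x * b x ^ 2 := by
    rw [Finset.mul_sum]
    refine Finset.sum_le_sum fun x hx => ?_
    have := mul_le_mul_of_nonneg_right (he x hx) (mul_nonneg (hm x hx) (sq_nonneg (b x)))
    nlinarith
  linarith

/-- Dyadic summation: polynomial growth of degree `n` controls sums of `t⁻⁽ⁿ⁺¹⁾`. -/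
lemma sum_div_pow_le_of_growth {ι : Type*} (F : Finset ι) (m t : ι → ℝ) (n : ℕ)
    {ρ c : ℝ} (hρ : 0 < ρ) (hm : ∀ y ∈ F, 0 ≤ m y) (ht : ∀ y ∈ F, ρ < t y)
    (hg : ∀ R : ℝ, 0 < R → ∑ y ∈ F with t y ≤ R, m y ≤ c * R ^ n) :
    ∑ y ∈ F, m y / t y ^ (n + 1) ≤ 2 ^ (n + 1) * c / ρ := by
  have hc : 0 ≤ c := by
    have := hg 1 one_pos
    have h0 : 0 ≤ ∑ y ∈ F with t y ≤ 1, m y :=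
      Finset.sum_nonneg fun y hy => hm y (Finset.mem_filter.1 hy).1
    simpa using h0.trans this
  have key : ∀ j : ℕ, ∑ y ∈ F with t y ≤ 2 ^ j * ρ, m y / t y ^ (n + 1) ≤
      2 ^ (n + 1) * c / ρ * (1 - (1 / 2) ^ j) := by
    intro j
    induction j with
    | zero =>
      rw [Finset.filter_false_of_mem]
      · simp
      · intro y hy
        simpa using ht y hy
    | succ j ih =>
      have hP : 0 < 2 ^ j * ρ := by positivity
      have hle : 2 ^ j * ρ ≤ 2 ^ (j + 1) * ρ := by
        rw [pow_succ]; nlinarith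
      have hsplit : ∑ y ∈ F with t y ≤ 2 ^ (j + 1) * ρ, m y / t y ^ (n + 1) ≤
          ∑ y ∈ F with t y ≤ 2 ^ j * ρ, m y / t y ^ (n + 1) +
          ∑ y ∈ F with t y ≤ 2 ^ (j + 1) * ρ, m y / (2 ^ j * ρ) ^ (n + 1) := by
        simp only [Finset.sum_filter]
        rw [← Finset.sum_add_distrib]
        refine Finset.sum_le_sum fun y hy => ?_
        have hmy := hm y hy
        by_cases h1 : t y ≤ 2 ^ j * ρ
        · have h2 := h1.trans hle
          simp only [h1, h2, if_true]
          have : 0 ≤ m y / (2 ^ j * ρ) ^ (n + 1) := by positivity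
          linarith
        · simp only [h1, if_false, zero_add]
          split_ifs with h2
          · have := (not_le.1 h1).le
            gcongr
          · exact le_rfl
      have hann : ∑ y ∈ F with t y ≤ 2 ^ (j + 1) * ρ, m y / (2 ^ j * ρ) ^ (n + 1) ≤
          2 ^ (n + 1) * c / ρ * (1 / 2) ^ (j + 1) := by
        rw [← Finset.sum_div]
        calc _ ≤ c * (2 ^ (j + 1) * ρ) ^ n / (2 ^ j * ρ) ^ (n + 1) := by
              gcongr
              exact hg _ (by positivity)
          _ = _ := by
              have h2 : (2 : ℝ) ^ (j + 1) * ρ = 2 * (2 ^ j * ρ) := by ring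
              rw [h2, mul_pow 2 (2 ^ j * ρ) n, one_div, inv_pow]
              field_simp
              ring
      calc _ ≤ _ := hsplit
        _ ≤ _ := add_le_add ih hann
        _ = _ := by ring
  obtain ⟨M, hM⟩ := (F.finite_toSet.image t).bddAbove
  obtain ⟨j, hj⟩ := pow_unbounded_of_one_lt (M / ρ) (one_lt_two)
  have hall : ∀ y ∈ F, t y ≤ 2 ^ j * ρ := fun y hy =>
    (hM (mem_image_of_mem t hy)).trans ((div_le_iff₀ hρ).1 hj.le)
  have := key j
  rw [Finset.filter_true_of_mem hall] at this
  refine this.trans (mul_le_of_le_one_right (by positivity) ?_)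
  have : (0 : ℝ) ≤ (1 / 2) ^ j := by positivity
  linarith

lemma inv_dist_pow_mul_inv_dist_pow_le {X : Type*} [MetricSpace X] (n : ℕ) {x y : X}
    (hxy : x ≠ y) (z : X) :
    (dist z x ^ (n + 1))⁻¹ * (dist z y ^ (n + 1))⁻¹ ≤
      2 ^ (n + 1) * (dist x y ^ (n + 1))⁻¹ *
        ((dist z x ^ (n + 1))⁻¹ + (dist z y ^ (n + 1))⁻¹) := by
  have hD : 0 < dist x y := dist_pos.2 hxy
  have htri : dist x y ≤ dist z x + dist z y := by
    simpa [dist_comm] using dist_triangle x z y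
  have half : ∀ a : ℝ, dist x y ≤ 2 * a →
      (a ^ (n + 1))⁻¹ ≤ 2 ^ (n + 1) * (dist x y ^ (n + 1))⁻¹ := by
    intro a ha
    have h : (dist x y) ^ (n + 1) ≤ 2 ^ (n + 1) * a ^ (n + 1) := by
      rw [← mul_pow]; gcongr
    have ha' : 0 < a := by linarith
    rw [← div_eq_mul_inv, le_div_iff₀ (by positivity), inv_mul_le_iff₀ (by positivity)]
    linarith
  have h0 : 0 ≤ (dist z x ^ (n + 1))⁻¹ := by positivity
  have h0' : 0 ≤ (dist z y ^ (n + 1))⁻¹ := by positivity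
  rcases le_total (dist z x) (dist z y) with h | h
  · have := half (dist z y) (by linarith)
    nlinarith
  · have := half (dist z x) (by linarith)
    nlinarith

/-- The bound for the discrete operator on a finite family of well separated balls. -/
lemma sum_sq_le_of_separated {X : Type*} [MetricSpace X] [DecidableEq X] (n : ℕ) {c : ℝ} (hc : 0 ≤ c)
    (F : Finset X) (r m b : X → ℝ) (hr : ∀ x ∈ F, 0 < r x)
    (hm : ∀ x ∈ F, 0 ≤ m x) (hb : ∀ x ∈ F, 0 ≤ b x)
    (hsep : ∀ x ∈ F, ∀ y ∈ F, x ≠ y → r x < dist y x)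
    (hmr : ∀ x ∈ F, m x ≤ c * r x ^ n)
    (hg : ∀ x ∈ F, ∀ R : ℝ, 0 < R → ∑ y ∈ F with y ≠ x ∧ dist y x ≤ R, m y ≤ c * R ^ n) :
    ∑ z ∈ F, m z * (∑ x ∈ F, r x / dist z x ^ (n + 1) * (m x * b x)) ^ 2 ≤
      (4 * (2 ^ (n + 1) * (2 ^ (n + 1) * c)) ^ 2 + 2 * (2 ^ (n + 1) * c * c)) *
        ∑ x ∈ F, m x * b x ^ 2 := by
  set K : ℝ := 2 ^ (n + 1) * c with hK
  have hcol : ∀ x ∈ F, ∑ z ∈ F, m z * (dist z x ^ (n + 1))⁻¹ ≤ K / r x := by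
    intro x hx
    have h := sum_div_pow_le_of_growth (F.filter (· ≠ x)) m (fun z => dist z x) n
      (c := c) (hr x hx) (fun y hy => hm y (Finset.mem_filter.1 hy).1)
      (fun y hy => hsep x hx y (Finset.mem_filter.1 hy).1 (Finset.mem_filter.1 hy).2.symm)
      (fun R hR => by rw [Finset.filter_filter]; exact hg x hx R hR)
    refine le_trans (le_of_eq ?_) h
    rw [Finset.sum_filter]
    refine Finset.sum_congr rfl fun z _ => ?_
    split_ifs with hz
    · rfl
    · simp [not_not.1 hz]
  refine sum_sq_le_of_compose_le F m b (fun x => K / r x ^ n)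
    (fun z x => r x / dist z x ^ (n + 1)) (2 ^ (n + 1) * K) (K * c) hm hb ?_ ?_
  · intro x hx y hy
    have hrx := hr x hx
    have hry := hr y hy
    rcases eq_or_ne x y with rfl | hxy
    · simp only [dist_self, if_true]
      have : ∀ z ∈ F, m z * (r x / dist z x ^ (n + 1) * (r x / dist z x ^ (n + 1))) ≤
          r x ^ 2 * (r x ^ (n + 1))⁻¹ * (m z * (dist z x ^ (n + 1))⁻¹) := by
        intro z hz
        have hmz := hm z hz
        rcases eq_or_ne x z with rfl | hxz
        · simp
        · have hd := hsep x hx z hz hxz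
          have h1 : (dist z x ^ (n + 1))⁻¹ ≤ (r x ^ (n + 1))⁻¹ := by gcongr
          have h2 : 0 ≤ r x ^ 2 * (m z * (dist z x ^ (n + 1))⁻¹) := by positivity
          have := mul_le_mul_of_nonneg_left h1 h2
          simp only [div_eq_mul_inv]
          nlinarith
      refine (Finset.sum_le_sum this).trans ?_
      rw [← Finset.mul_sum]
      refine (mul_le_mul_of_nonneg_left (hcol x hx) (by positivity)).trans (le_of_eq ?_)
      simp only [ne_eq, Nat.add_eq_zero_iff, one_ne_zero, and_false, not_false_eq_true, zero_pow,
        div_zero, add_zero, mul_zero, zero_add]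
      field_simp
      ring
    · simp only [hxy, if_false, add_zero]
      have : ∀ z ∈ F, m z * (r x / dist z x ^ (n + 1) * (r y / dist z y ^ (n + 1))) ≤
          r x * r y * (2 ^ (n + 1) * (dist x y ^ (n + 1))⁻¹) *
            (m z * (dist z x ^ (n + 1))⁻¹ + m z * (dist z y ^ (n + 1))⁻¹) := by
        intro z hz
        have h1 : 0 ≤ r x * r y * m z := mul_nonneg (by positivity) (hm z hz)
        have := mul_le_mul_of_nonneg_left (inv_dist_pow_mul_inv_dist_pow_le n hxy z) h1
        simp only [div_eq_mul_inv]
        linarith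
      refine (Finset.sum_le_sum this).trans ?_
      rw [← Finset.mul_sum, Finset.sum_add_distrib]
      refine (mul_le_mul_of_nonneg_left (add_le_add (hcol x hx) (hcol y hy))
        (by positivity)).trans (le_of_eq ?_)
      rw [dist_comm y x]
      field_simp
  · intro x hx
    have hrx := hr x hx
    have hK0 : 0 ≤ K := by positivity
    calc m x * (K / r x ^ n) ≤ c * r x ^ n * (K / r x ^ n) := by
          gcongr
          exact hmr x hx
      _ = K * c := by field_simp

lemma le_ballsDist_of_separated {d : ℕ} {x y : Euc d} {s t : ℝ} (hs : 0 ≤ s) (ht : 0 ≤ t)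
    (h : 2 * s + 2 * t ≤ dist x y) :
    dist x y / 2 ≤ ballsDist (closedBall x s) (closedBall y t) := by
  refine le_csInf ⟨_, x, mem_closedBall_self hs, y, mem_closedBall_self ht, rfl⟩ ?_
  rintro _ ⟨a, ha, b, hb, rfl⟩
  have h1 := dist_triangle4 x a b y
  rw [mem_closedBall] at ha hb
  rw [dist_comm x a] at h1
  linarith

lemma sq_lintegral_le_measure_mul {α : Type*} [MeasurableSpace α] (μ : Measure α)
    {g : α → ℝ≥0∞} (hg : AEMeasurable g μ) :
    (∫⁻ a, g a ∂μ) ^ 2 ≤ μ univ * ∫⁻ a, g a ^ 2 ∂μ := by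
  have h := ENNReal.lintegral_mul_le_Lp_mul_Lq μ Real.HolderConjugate.two_two
    (aemeasurable_const (b := (1 : ℝ≥0∞))) hg
  simp only [Pi.mul_apply, one_mul, ENNReal.one_rpow, lintegral_const] at h
  calc (∫⁻ a, g a ∂μ) ^ 2 ≤ _ := pow_le_pow_left' h 2
    _ = _ := by
      rw [mul_pow, ← ENNReal.rpow_natCast, ← ENNReal.rpow_natCast, ← ENNReal.rpow_mul,
        ← ENNReal.rpow_mul]
      norm_num

/-- A weighted `ℓ²` bound for `∑ K a` follows from the same bound on all finite sections. -/
lemma tsum_mul_sq_tsum_le {ι : Type*} (K : ι → ι → ℝ≥0∞) (m a : ι → ℝ≥0∞) (B : ℝ≥0∞)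
    (hm : ∀ z, m z ≠ ∞)
    (h : ∀ F : Finset ι, ∑ z ∈ F, m z * (∑ x ∈ F, K z x * a x) ^ 2 ≤ B) :
    ∑' z, m z * (∑' x, K z x * a x) ^ 2 ≤ B := by
  classical
  refine ENNReal.summable.tsum_le_of_sum_le fun G => ?_
  have hlim : Tendsto (fun F : Finset ι => ∑ z ∈ G, m z * (∑ x ∈ F, K z x * a x) ^ 2) atTop
      (𝓝 (∑ z ∈ G, m z * (∑' x, K z x * a x) ^ 2)) := by
    refine tendsto_finsetSum _ fun z _ => ENNReal.Tendsto.const_mul ?_ (Or.inr (hm z))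
    exact ((ENNReal.continuous_pow 2).tendsto _).comp ENNReal.summable.hasSum
  refine le_of_tendsto hlim (Eventually.of_forall fun F => ?_)
  refine le_trans ?_ (h (G ∪ F))
  refine (Finset.sum_le_sum fun z _ => ?_).trans
    (Finset.sum_le_sum_of_subset Finset.subset_union_left)
  gcongr
  exact Finset.subset_union_right

/-- The real-variable finite bound, transported to finite families of balls and a measure of growth
of degree `n`. -/
lemma sum_measure_mul_sq_le {d n : ℕ} {c₀ : ℝ} {ν : Measure (Euc d)} [IsFiniteMeasure ν]
    (hν : GrowthDeg n ν c₀) {r : Euc d → ℝ} (F : Finset (Euc d)) (hr : ∀ x ∈ F, 0 < r x)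
    (hdisj : (F : Set (Euc d)).PairwiseDisjoint (fun x => closedBall x (2 * r x)))
    {g : Euc d → ℝ≥0∞} (hg : Measurable g) (hfin : ∫⁻ z, g z ^ 2 ∂ν ≠ ∞) :
    ∑ z ∈ F, ν (closedBall z (r z)) * (∑ x ∈ F, ENNReal.ofReal (r x / dist z x ^ (n + 1)) *
        ∫⁻ y in closedBall x (r x), g y ∂ν) ^ 2 ≤
      ENNReal.ofReal (4 * (2 ^ (n + 1) * (2 ^ (n + 1) * (2 ^ n * |c₀|))) ^ 2 +
        2 * (2 ^ (n + 1) * (2 ^ n * |c₀|) * (2 ^ n * |c₀|))) * ∫⁻ z, g z ^ 2 ∂ν := by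
  classical
  set c : ℝ := 2 ^ n * |c₀| with hcdef
  have hc : 0 ≤ c := by positivity
  have hsep : ∀ x ∈ F, ∀ y ∈ F, x ≠ y → 2 * r x + 2 * r y < dist y x := fun x hx y hy hxy => by
    have hrx := hr x hx
    have hry := hr y hy
    rw [dist_comm]
    exact (disjoint_closedBall_closedBall_iff (by positivity) (by positivity)).1 (hdisj hx hy hxy)
  have hdisj' : (F : Set (Euc d)).PairwiseDisjoint (fun x => closedBall x (r x)) := by
    refine fun x hx y hy hxy => (hdisj hx hy hxy).mono ?_ ?_ <;>
      refine closedBall_subset_closedBall ?_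
    · linarith [hr x hx]
    · linarith [hr y hy]
  have hgrowth : ∀ (x : Euc d) (R : ℝ), 0 < R → ν.real (closedBall x R) ≤ |c₀| * R ^ n := by
    intro x R hR
    refine ENNReal.toReal_le_of_le_ofReal (by positivity) ((hν x R hR).trans ?_)
    refine ENNReal.ofReal_le_ofReal ?_
    gcongr
    exact le_abs_self _
  have hsub : ∀ x ∈ F, ∫⁻ y in closedBall x (r x), g y ^ 2 ∂ν ≠ ∞ := fun x _ =>
    ((setLIntegral_le_lintegral _ _).trans_lt hfin.lt_top).ne
  set m : Euc d → ℝ := fun x => ν.real (closedBall x (r x)) with hm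
  set a : Euc d → ℝ := fun x => (∫⁻ y in closedBall x (r x), g y ∂ν).toReal with ha
  have hcs : ∀ x, (∫⁻ y in closedBall x (r x), g y ∂ν) ^ 2 ≤
      ν (closedBall x (r x)) * ∫⁻ y in closedBall x (r x), g y ^ 2 ∂ν := fun x => by
    simpa using sq_lintegral_le_measure_mul (ν.restrict (closedBall x (r x))) hg.aemeasurable
  have hafin : ∀ x ∈ F, ∫⁻ y in closedBall x (r x), g y ∂ν ≠ ∞ := fun x hx htop => by
    have := hcs x
    rw [htop] at this
    exact ENNReal.mul_ne_top (measure_ne_top ν _) (hsub x hx) (top_le_iff.1 (by simpa using this))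
  have hcs' : ∀ x ∈ F, a x ^ 2 ≤ m x * (∫⁻ y in closedBall x (r x), g y ^ 2 ∂ν).toReal :=
    fun x hx => by
      have := ENNReal.toReal_mono (ENNReal.mul_ne_top (measure_ne_top ν _) (hsub x hx)) (hcs x)
      simpa [ENNReal.toReal_mul, ENNReal.toReal_pow, hm, ha, measureReal_def] using this
  have hm0 : ∀ x, 0 ≤ m x := fun x => measureReal_nonneg
  have ha0 : ∀ x, 0 ≤ a x := fun x => ENNReal.toReal_nonneg
  have hmb : ∀ x ∈ F, m x * (a x / m x) = a x := fun x hx => by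
    rcases eq_or_ne (m x) 0 with h | h
    · have := hcs' x hx
      rw [h, zero_mul] at this
      rw [h, zero_mul, pow_eq_zero_iff two_ne_zero |>.1 (le_antisymm this (sq_nonneg _))]
    · field_simp
  have hmb2 : ∀ x ∈ F, m x * (a x / m x) ^ 2 ≤
      (∫⁻ y in closedBall x (r x), g y ^ 2 ∂ν).toReal := fun x hx => by
    rcases (hm0 x).eq_or_lt with h | h
    · rw [← h, zero_mul]
      exact ENNReal.toReal_nonneg
    · have := hcs' x hx
      rw [div_pow, mul_div_assoc', div_le_iff₀ (by positivity)]
      nlinarith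
  have key := sum_sq_le_of_separated n hc F r m (fun x => a x / m x) hr (fun x _ => hm0 x)
    (fun x _ => div_nonneg (ha0 x) (hm0 x))
    (fun x hx y hy hxy => by linarith [hsep x hx y hy hxy, hr x hx, hr y hy])
    (fun x hx => (hgrowth x _ (hr x hx)).trans (by
      have := hr x hx
      rw [hcdef]
      gcongr
      exact le_mul_of_one_le_left (abs_nonneg _) (one_le_pow₀ one_le_two)))
    (fun x hx R hR => by
      have hu : (⋃ y ∈ F.filter (fun y => y ≠ x ∧ dist y x ≤ R), closedBall y (r y)) ⊆
          closedBall x (2 * R) := by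
        refine iUnion₂_subset fun y hy => closedBall_subset_closedBall' ?_
        rw [Finset.mem_filter] at hy
        linarith [hsep x hx y hy.1 hy.2.1.symm, hr x hx, hr y hy.1, hy.2.2]
      calc ∑ y ∈ F with y ≠ x ∧ dist y x ≤ R, m y
          = ν.real (⋃ y ∈ F.filter (fun y => y ≠ x ∧ dist y x ≤ R), closedBall y (r y)) := by
            rw [measureReal_biUnion_finset]
            · exact hdisj'.subset (Finset.coe_subset.2 (Finset.filter_subset _ _))
            · exact fun y _ => measurableSet_closedBall
        _ ≤ ν.real (closedBall x (2 * R)) := measureReal_mono hu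
        _ ≤ |c₀| * (2 * R) ^ n := hgrowth x _ (by positivity)
        _ = c * R ^ n := by rw [mul_pow, hcdef]; ring)
  have hlhs : ∑ z ∈ F, ν (closedBall z (r z)) *
      (∑ x ∈ F, ENNReal.ofReal (r x / dist z x ^ (n + 1)) *
        ∫⁻ y in closedBall x (r x), g y ∂ν) ^ 2 =
      ENNReal.ofReal (∑ z ∈ F, m z * (∑ x ∈ F, r x / dist z x ^ (n + 1) *
        (m x * (a x / m x))) ^ 2) := by
    have hk : ∀ z, ∀ x ∈ F, 0 ≤ r x / dist z x ^ (n + 1) := fun z x hx => by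
      have := hr x hx
      positivity
    have hin : ∀ z, ∀ x ∈ F, 0 ≤ r x / dist z x ^ (n + 1) * (m x * (a x / m x)) := fun z x hx =>
      mul_nonneg (hk z x hx) (by rw [hmb x hx]; exact ha0 x)
    rw [ENNReal.ofReal_sum_of_nonneg fun z _ => mul_nonneg (hm0 z) (sq_nonneg _)]
    refine Finset.sum_congr rfl fun z hz => ?_
    rw [ENNReal.ofReal_mul (hm0 z), ENNReal.ofReal_pow (Finset.sum_nonneg (hin z)),
      ENNReal.ofReal_sum_of_nonneg (hin z), hm, ofReal_measureReal]
    congr 2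
    refine Finset.sum_congr rfl fun x hx => ?_
    rw [ENNReal.ofReal_mul (hk z x hx)]
    congr 1
    have := hmb x hx
    simp only [hm] at this
    rw [this, ENNReal.ofReal_toReal (hafin x hx)]
  rw [hlhs]
  refine (ENNReal.ofReal_le_ofReal key).trans ?_
  rw [ENNReal.ofReal_mul (by positivity)]
  gcongr
  calc ENNReal.ofReal (∑ x ∈ F, m x * (a x / m x) ^ 2)
      ≤ ENNReal.ofReal (∑ x ∈ F, (∫⁻ y in closedBall x (r x), g y ^ 2 ∂ν).toReal) :=
        ENNReal.ofReal_le_ofReal (Finset.sum_le_sum hmb2)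
    _ = ∑ x ∈ F, ∫⁻ y in closedBall x (r x), g y ^ 2 ∂ν := by
        rw [ENNReal.ofReal_sum_of_nonneg fun _ _ => ENNReal.toReal_nonneg]
        exact Finset.sum_congr rfl fun x hx => ENNReal.ofReal_toReal (hsub x hx)
    _ = ∫⁻ y in ⋃ x ∈ F, closedBall x (r x), g y ^ 2 ∂ν :=
        (lintegral_biUnion_finset hdisj' (fun _ _ => measurableSet_closedBall) _).symm
    _ ≤ ∫⁻ y, g y ^ 2 ∂ν := setLIntegral_le_lintegral _ _

/-- The operator `T_ν f(z) = Σ_{x∈H : z∉B_x} r(x)/dist(B(z),B_x)^{n+1} ∫_{B_x} f dν` is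
bounded in `L²(ν)`, with norm depending only on `d`, `n` and the growth constant `c₀`
(stated for `|f|`, with its `L²(ν)`-norm squared written as a sum over the disjoint balls
carrying `ν`). -/
theorem tnu_bounded (d n : ℕ) (c₀ : ℝ) :
    ∃ C : ℝ, 0 < C ∧
    ∀ ν : Measure (Euc d), IsFiniteMeasure ν → GrowthDeg n ν c₀ →
    ∀ H : Set (Euc d), H.Countable →
    ∀ r : Euc d → ℝ, (∀ x ∈ H, 0 < r x) →
      H.PairwiseDisjoint (fun x => closedBall x (2 * r x)) →
      ν (⋃ x ∈ H, closedBall x (r x))ᶜ = 0 →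
    ∀ f : Euc d → ℝ, Measurable f →
      ∑' x₀ : H, ∫⁻ z in closedBall x₀.1 (r x₀.1),
          (∑' x : {x : Euc d // x ∈ H ∧ z ∉ closedBall x (r x)},
            ENNReal.ofReal
                (r x.1 / ballsDist (closedBall x₀.1 (r x₀.1)) (closedBall x.1 (r x.1)) ^ (n + 1)) *
              ∫⁻ y in closedBall x.1 (r x.1), (‖f y‖₊ : ℝ≥0∞) ∂ν) ^ 2 ∂ν
        ≤ ENNReal.ofReal C * ∫⁻ z, (‖f z‖₊ : ℝ≥0∞) ^ 2 ∂ν := by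
  set D : ℝ := 4 * (2 ^ (n + 1) * (2 ^ (n + 1) * (2 ^ n * |c₀|))) ^ 2 +
        2 * (2 ^ (n + 1) * (2 ^ n * |c₀|) * (2 ^ n * |c₀|)) with hD
  have hD0 : 0 ≤ D := by positivity
  have hC : 0 < (2 ^ (n + 1)) ^ 2 * D + 1 := by positivity
  refine ⟨(2 ^ (n + 1)) ^ 2 * D + 1, hC, ?_⟩
  intro ν _ hν H _ r hr hdisj _ f hf
  by_cases hfin : ∫⁻ z, (‖f z‖₊ : ℝ≥0∞) ^ 2 ∂ν = ∞
  · rw [hfin, ENNReal.mul_top (by simpa using hC)]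
    exact le_top
  set g : Euc d → ℝ≥0∞ := fun z => (‖f z‖₊ : ℝ≥0∞) with hg
  have hgm : Measurable g := hf.nnnorm.coe_nnreal_ennreal
  have hker : ∀ x₀ ∈ H, ∀ x ∈ H, x₀ ≠ x →
      r x / ballsDist (closedBall x₀ (r x₀)) (closedBall x (r x)) ^ (n + 1) ≤
        2 ^ (n + 1) * (r x / dist x₀ x ^ (n + 1)) := by
    intro x₀ hx₀ x hx hne
    have h0 := hr x₀ hx₀
    have h1 := hr x hx
    have hlt := (disjoint_closedBall_closedBall_iff (by positivity) (by positivity)).1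
      (hdisj hx₀ hx hne)
    have hle := le_ballsDist_of_separated h0.le h1.le hlt.le
    have hpos : 0 < dist x₀ x := dist_pos.2 hne
    calc _ ≤ r x / (dist x₀ x / 2) ^ (n + 1) := by gcongr
      _ = _ := by rw [div_pow]; field_simp
  have hsections : ∑' z : H, ν (closedBall z.1 (r z.1)) *
      (∑' x : H, ENNReal.ofReal (r x.1 / dist z.1 x.1 ^ (n + 1)) *
        ∫⁻ y in closedBall x.1 (r x.1), g y ∂ν) ^ 2 ≤ ENNReal.ofReal D * ∫⁻ z, g z ^ 2 ∂ν := by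
    refine tsum_mul_sq_tsum_le
      (fun z x : H => ENNReal.ofReal (r x.1 / dist z.1 x.1 ^ (n + 1)))
      (fun z : H => ν (closedBall z.1 (r z.1)))
      (fun x : H => ∫⁻ y in closedBall x.1 (r x.1), g y ∂ν) _
      (fun _ => measure_ne_top ν _) fun F => ?_
    have hF : ∀ x ∈ F.map (Function.Embedding.subtype (· ∈ H)), x ∈ H := fun x hx =>
      Finset.property_of_mem_map_subtype F hx
    have := sum_measure_mul_sq_le hν (F.map (Function.Embedding.subtype (· ∈ H)))
      (fun x hx => hr x (hF x hx)) (hdisj.subset fun x hx => hF x hx) hgm hfin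
    simpa only [Finset.sum_map, Function.Embedding.subtype_apply] using this
  calc _ ≤ ∑' z : H, ENNReal.ofReal ((2 ^ (n + 1)) ^ 2) * (ν (closedBall z.1 (r z.1)) *
      (∑' x : H, ENNReal.ofReal (r x.1 / dist z.1 x.1 ^ (n + 1)) *
        ∫⁻ y in closedBall x.1 (r x.1), g y ∂ν) ^ 2) := by
        refine ENNReal.tsum_le_tsum fun x₀ => ?_
        refine (setLIntegral_mono' (g := fun _ => (ENNReal.ofReal (2 ^ (n + 1)) *
          ∑' x : H, ENNReal.ofReal (r x.1 / dist x₀.1 x.1 ^ (n + 1)) *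
            ∫⁻ y in closedBall x.1 (r x.1), g y ∂ν) ^ 2)
          measurableSet_closedBall fun z hz => ?_).trans (le_of_eq ?_)
        · gcongr
          rw [← ENNReal.tsum_mul_left]
          let φ : {x : Euc d // x ∈ H ∧ z ∉ closedBall x (r x)} → H := fun x => ⟨x.1, x.2.1⟩
          have hφ : Function.Injective φ := fun x y h => Subtype.ext (Subtype.mk.inj h)
          refine le_trans (ENNReal.tsum_le_tsum fun x => ?_)
            (ENNReal.tsum_comp_le_tsum_of_injective hφ _)
          have hne : x₀.1 ≠ x.1 := fun h => x.2.2 (h ▸ hz)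
          rw [← mul_assoc, ← ENNReal.ofReal_mul (by positivity)]
          gcongr
          exact hker _ x₀.2 _ x.2.1 hne
        · rw [setLIntegral_const, mul_pow, ← ENNReal.ofReal_pow (by positivity) 2, mul_assoc,
            mul_comm (_ ^ 2) (ν _)]
    _ ≤ ENNReal.ofReal ((2 ^ (n + 1)) ^ 2) * (ENNReal.ofReal D * ∫⁻ z, g z ^ 2 ∂ν) := by
        rw [ENNReal.tsum_mul_left]
        gcongr
    _ ≤ _ := by
        rw [← mul_assoc, ← ENNReal.ofReal_mul (by positivity)]
        gcongr
        linarith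
end
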